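/- Let r be a nonnegative integer and M a definable C^r submanifold of ℝ^m. Then there exist a definable C^r submanifold M' of ℝ^{m+1} that is closed in ℝ^{m+1} and a definable C^r diffeomorphism from M onto M'. -/

import Mathlib

open FirstOrder Set Topology

namespace Paper

variable (L : FirstOrder.Language) [L.Structure ℝ]

/-- A subset of `ℝⁿ` is definable in the structure (with parameters from `ℝ`). -/
def Def (n : ℕ) (s : Set (Fin n → ℝ)) : Prop :=
  Set.Definable (Set.univ : Set ℝ) L s

/-- A subset of `ℝ` is definable. -/
def Def1 (s : Set ℝ) : Prop := Def L 1 {x | x 0 ∈ s}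

/-- The structure expands the ordered field `(ℝ, <, +, ·, 0, 1)`:
the order and the field operations (and the constants) are definable. -/
def ExpandsOrderedField : Prop :=
  Def L 2 {x | x 0 < x 1} ∧ Def L 3 {x | x 0 + x 1 = x 2} ∧
  Def L 3 {x | x 0 * x 1 = x 2} ∧ Def L 1 {x | x 0 = 0} ∧ Def L 1 {x | x 0 = 1}

/-- Local o-minimality: every definable subset of `ℝ` is, near each point, a finite
union of points and open intervals. -/
def LocallyOMinimal : Prop :=
  ∀ X : Set ℝ, Def1 L X → ∀ a : ℝ,
    ∃ b c : ℝ, b < a ∧ a < c ∧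
      ∃ (P : Finset ℝ) (J : Finset (ℝ × ℝ)),
        X ∩ Set.Ioo b c = ↑P ∪ ⋃ p ∈ J, Set.Ioo p.1 p.2

/-- First component of a point of `ℝ^(m+n) = ℝ^m × ℝ^n`. -/
def fstFun {m n : ℕ} (z : Fin (m + n) → ℝ) : Fin m → ℝ := fun i => z (Fin.castAdd n i)

/-- Second component of a point of `ℝ^(m+n) = ℝ^m × ℝ^n`. -/
def sndFun {m n : ℕ} (z : Fin (m + n) → ℝ) : Fin n → ℝ := fun j => z (Fin.natAdd m j)

/-- The map `f : X → ℝⁿ`, `X ⊆ ℝ^m`, is definable (its graph over `X` is definable). -/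
def DefMapOn (m n : ℕ) (X : Set (Fin m → ℝ)) (f : (Fin m → ℝ) → (Fin n → ℝ)) : Prop :=
  Def L (m + n) {z | fstFun z ∈ X ∧ sndFun z = f (fstFun z)}

/-- The function `f : X → ℝ`, `X ⊆ ℝ^m`, is definable. -/
def DefFunOn (m : ℕ) (X : Set (Fin m → ℝ)) (f : (Fin m → ℝ) → ℝ) : Prop :=
  DefMapOn L m 1 X fun x _ => f x

/-- `f` is of class `C^r` on `X` in the sense that near every point of `X` it agrees on `X`
with a `C^r` map defined on an open neighborhood in the ambient space. -/
def CrMapOn (r m n : ℕ) (X : Set (Fin m → ℝ)) (f : (Fin m → ℝ) → (Fin n → ℝ)) : Prop :=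
  ∀ a ∈ X, ∃ (W : Set (Fin m → ℝ)) (g : (Fin m → ℝ) → (Fin n → ℝ)),
    a ∈ W ∧ IsOpen W ∧ ContDiffOn ℝ r g W ∧ Set.EqOn f g (X ∩ W)

/-- Real-valued version of `CrMapOn`. -/
def CrFunOn (r m : ℕ) (X : Set (Fin m → ℝ)) (f : (Fin m → ℝ) → ℝ) : Prop :=
  ∀ a ∈ X, ∃ (W : Set (Fin m → ℝ)) (g : (Fin m → ℝ) → ℝ),
    a ∈ W ∧ IsOpen W ∧ ContDiffOn ℝ r g W ∧ Set.EqOn f g (X ∩ W)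

/-- A definable `C^r` map `X → ℝⁿ`. -/
def DefCrMapOn (r m n : ℕ) (X : Set (Fin m → ℝ)) (f : (Fin m → ℝ) → (Fin n → ℝ)) : Prop :=
  DefMapOn L m n X f ∧ CrMapOn r m n X f

/-- A definable `C^r` function `X → ℝ`. -/
def DefCrFunOn (r m : ℕ) (X : Set (Fin m → ℝ)) (f : (Fin m → ℝ) → ℝ) : Prop :=
  DefFunOn L m X f ∧ CrFunOn r m X f

/-- A definable `C^r` submanifold of `ℝⁿ` of dimension `d`: around every point there is a
definable `C^r` chart of `ℝⁿ` straightening `M` to the first `d` coordinates. -/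
def IsDefCrSubmanifold (r n d : ℕ) (M : Set (Fin n → ℝ)) : Prop :=
  Def L n M ∧
  ∀ a ∈ M, ∃ (U V : Set (Fin n → ℝ)) (φ ψ : (Fin n → ℝ) → (Fin n → ℝ)),
    a ∈ U ∧ IsOpen U ∧ Def L n U ∧
    (0 : Fin n → ℝ) ∈ V ∧ IsOpen V ∧ Def L n V ∧
    DefMapOn L n n U φ ∧ DefMapOn L n n V ψ ∧
    ContDiffOn ℝ r φ U ∧ ContDiffOn ℝ r ψ V ∧
    Set.BijOn φ U V ∧ Set.InvOn ψ φ U V ∧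
    φ a = 0 ∧
    φ '' (M ∩ U) = {x ∈ V | ∀ i : Fin n, d ≤ (i : ℕ) → x i = 0}

/-- The Euclidean norm on `ℝⁿ`. -/
noncomputable def eunorm {n : ℕ} (x : Fin n → ℝ) : ℝ := Real.sqrt (∑ i, x i ^ 2)

/-- Projection of `ℝⁿ` onto the `d` coordinates selected by `σ`. -/
def coordProj {n : ℕ} (d : ℕ) (σ : Fin d → Fin n) (x : Fin n → ℝ) : Fin d → ℝ :=
  fun i => x (σ i)

/-- `X ⊆ ℝⁿ` has dimension `d`: `d` is the largest integer such that some coordinate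
projection of `X` onto `ℝ^d` has nonempty interior. -/
def HasDim {n : ℕ} (X : Set (Fin n → ℝ)) (d : ℕ) : Prop :=
  (∃ σ : Fin d → Fin n, Function.Injective σ ∧ (interior (coordProj d σ '' X)).Nonempty) ∧
  ∀ (e : ℕ) (σ : Fin e → Fin n), Function.Injective σ →
    (interior (coordProj e σ '' X)).Nonempty → e ≤ d

/-- A (bounded) open box in `ℝⁿ`. -/
def IsOpenBox {n : ℕ} (B : Set (Fin n → ℝ)) : Prop :=
  ∃ a b : Fin n → ℝ, (∀ i, a i < b i) ∧ B = Set.pi Set.univ fun i => Set.Ioo (a i) (b i)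

section
variable {L : FirstOrder.Language} [L.Structure ℝ]

/-- A locally o-minimal structure on `ℝ` expanding the ordered field. -/
class LocallyOMinimalField (L : FirstOrder.Language) [L.Structure ℝ] : Prop where
  field : ExpandsOrderedField L
  lomin : LocallyOMinimal L

/-- A space identified with some `ℝⁿ` by means of named coordinates. -/
class Coord (E : Type) where
  Index : Type
  finite_index : Finite Index
  equiv : E ≃ (Index → ℝ)

attribute [instance] Coord.finite_index

instance : Coord ℝ := ⟨Unit, inferInstance, (Equiv.funUnique Unit ℝ).symm⟩

instance {ι : Type} [Finite ι] : Coord (ι → ℝ) := ⟨ι, inferInstance, Equiv.refl _⟩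

instance {E F : Type} [Coord E] [Coord F] : Coord (E × F) :=
  ⟨Coord.Index E ⊕ Coord.Index F, inferInstance,
    (Equiv.prodCongr Coord.equiv Coord.equiv).trans
      (Equiv.sumArrowEquivProdArrow _ _ _).symm⟩

variable {E F G H : Type} [Coord E] [Coord F] [Coord G] [Coord H] {ι : Type} [Finite ι]

/-- Definable predicates on a coordinatized space. -/
def DefPred (L : FirstOrder.Language) [L.Structure ℝ] (P : E → Prop) : Prop :=
  (Set.univ : Set ℝ).Definable L {v : Coord.Index E → ℝ | P (Coord.equiv.symm v)}

/-- Definable maps between coordinatized spaces. -/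
@[fun_prop]
def DefFun (L : FirstOrder.Language) [L.Structure ℝ] (f : E → F) : Prop :=
  DefPred L fun p : E × F => p.2 = f p.1

namespace DefPred

theorem congr {P Q : E → Prop} (hP : DefPred L P) (h : ∀ x, Q x ↔ P x) : DefPred L Q := by
  rwa [show Q = P from funext fun x => propext (h x)]

protected theorem and {P Q : E → Prop} (hP : DefPred L P) (hQ : DefPred L Q) :
    DefPred L fun x => P x ∧ Q x :=
  Set.Definable.inter hP hQ

protected theorem or {P Q : E → Prop} (hP : DefPred L P) (hQ : DefPred L Q) :
    DefPred L fun x => P x ∨ Q x :=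
  Set.Definable.union hP hQ

protected theorem not {P : E → Prop} (hP : DefPred L P) : DefPred L fun x => ¬ P x :=
  Set.Definable.compl hP

protected theorem imp {P Q : E → Prop} (hP : DefPred L P) (hQ : DefPred L Q) :
    DefPred L fun x => P x → Q x :=
  (hP.not.or hQ).congr fun _ => imp_iff_not_or

protected theorem iff {P Q : E → Prop} (hP : DefPred L P) (hQ : DefPred L Q) :
    DefPred L fun x => P x ↔ Q x :=
  ((hP.imp hQ).and (hQ.imp hP)).congr fun _ => iff_iff_implies_and_implies

theorem const (c : Prop) : DefPred L fun _ : E => c := by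
  by_cases h : c
  · have : DefPred L fun _ : E => True := Set.definable_univ
    exact this.congr fun _ => by simp [h]
  · have : DefPred L fun _ : E => False := Set.definable_empty
    exact this.congr fun _ => by simp [h]

theorem forall_finite {κ : Type} [Finite κ] {P : κ → E → Prop} (h : ∀ k, DefPred L (P k)) :
    DefPred L fun x => ∀ k, P k x := by
  have := Set.definable_iInter_of_finite h
  unfold DefPred
  convert this using 1
  ext v
  simp

theorem exists_finite {κ : Type} [Finite κ] {P : κ → E → Prop} (h : ∀ k, DefPred L (P k)) :
    DefPred L fun x => ∃ k, P k x :=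
  (forall_finite fun k => (h k).not).not.congr fun x => by simp

protected theorem ex {P : E → F → Prop} (h : DefPred L fun p : E × F => P p.1 p.2) :
    DefPred L fun x => ∃ y, P x y := by
  have := Set.Definable.exists_of_finite (α := Coord.Index E) (β := Coord.Index F) h
  unfold DefPred
  convert this using 1
  ext v
  refine ⟨fun ⟨y, hy⟩ => ⟨Coord.equiv y, ?_⟩, fun ⟨u, hu⟩ => ⟨Coord.equiv.symm u, hu⟩⟩
  rw [← Equiv.symm_apply_apply Coord.equiv y] at hy
  exact hy

protected theorem all {P : E → F → Prop} (h : DefPred L fun p : E × F => P p.1 p.2) :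
    DefPred L fun x => ∀ y, P x y :=
  (DefPred.ex (P := fun x y => ¬ P x y) h.not).not.congr fun x => by simp

theorem reindex {P : F → Prop} (hP : DefPred L P) (φ : E → F)
    (τ : Coord.Index F → Coord.Index E)
    (h : ∀ x, Coord.equiv (φ x) = Coord.equiv x ∘ τ) : DefPred L fun x => P (φ x) := by
  have := Set.Definable.preimage_comp τ hP
  unfold DefPred
  convert this using 1
  ext v
  have : φ (Coord.equiv.symm v) = Coord.equiv.symm (v ∘ τ) := by
    rw [Equiv.eq_symm_apply, h, Equiv.apply_symm_apply]
  simp [this]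

theorem index_eq (i j : Coord.Index E) :
    DefPred L fun x : E => Coord.equiv x i = Coord.equiv x j := by
  refine ⟨((Language.Term.var i).equal (Language.Term.var j)), ?_⟩
  ext v
  simp

theorem comp_fst {P : E → Prop} (hP : DefPred L P) : DefPred L fun p : E × F => P p.1 :=
  hP.reindex Prod.fst Sum.inl fun _ => rfl

theorem comp_snd {P : F → Prop} (hP : DefPred L P) : DefPred L fun p : E × F => P p.2 :=
  hP.reindex Prod.snd Sum.inr fun _ => rfl

theorem comp {P : F → Prop} {f : E → F} (hP : DefPred L P) (hf : DefFun L f) :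
    DefPred L fun x => P (f x) :=
  (DefPred.ex (P := fun x y => y = f x ∧ P y) (hf.and hP.comp_snd)).congr fun x => by simp

end DefPred

namespace DefFun

theorem reindex (φ : E → F) (τ : Coord.Index F → Coord.Index E)
    (h : ∀ x, Coord.equiv (φ x) = Coord.equiv x ∘ τ) : DefFun L φ := by
  refine (DefPred.forall_finite fun i : Coord.Index F =>
    DefPred.index_eq (E := E × F) (Sum.inr i) (Sum.inl (τ i))).congr fun p => ?_
  rw [← Coord.equiv.injective.eq_iff, h, funext_iff]
  rfl

@[fun_prop]
protected theorem id : DefFun L fun x : E => x := reindex _ id fun _ => rfl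

@[fun_prop]
protected theorem fst' : DefFun L fun p : E × F => p.1 := reindex _ Sum.inl fun _ => rfl

@[fun_prop]
protected theorem snd' : DefFun L fun p : E × F => p.2 := reindex _ Sum.inr fun _ => rfl

@[fun_prop]
theorem comp {g : F → G} {f : E → F} (hg : DefFun L g) (hf : DefFun L f) :
    DefFun L fun x => g (f x) := by
  refine (DefPred.ex (E := E × G) (F := F) (P := fun p y => y = f p.1 ∧ p.2 = g y)
    (DefPred.and ?_ ?_)).congr fun x => by simp
  · exact DefPred.reindex hf (fun p : (E × G) × F => (p.1.1, p.2)) (Sum.elim (Sum.inl ∘ Sum.inl) Sum.inr)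
      fun p => by ext (i | i) <;> rfl
  · exact DefPred.reindex hg (fun p : (E × G) × F => (p.2, p.1.2))
      (Sum.elim Sum.inr (Sum.inl ∘ Sum.inr)) fun p => by ext (i | i) <;> rfl

@[fun_prop]
theorem prodMk {f : E → F} {g : E → G} (hf : DefFun L f) (hg : DefFun L g) :
    DefFun L fun x => (f x, g x) := by
  refine (DefPred.and (DefPred.reindex hf (fun p : E × (F × G) => (p.1, p.2.1))
      (Sum.elim Sum.inl (Sum.inr ∘ Sum.inl)) fun p => by ext (i | i) <;> rfl)
    (DefPred.reindex hg (fun p : E × (F × G) => (p.1, p.2.2))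
      (Sum.elim Sum.inl (Sum.inr ∘ Sum.inr)) fun p => by ext (i | i) <;> rfl)).congr
    fun p => Prod.ext_iff

@[fun_prop]
theorem fst {f : E → F × G} (hf : DefFun L f) : DefFun L fun x => (f x).1 :=
  DefFun.fst'.comp hf

@[fun_prop]
theorem snd {f : E → F × G} (hf : DefFun L f) : DefFun L fun x => (f x).2 :=
  DefFun.snd'.comp hf

@[fun_prop]
theorem apply (i : ι) : DefFun L fun x : ι → ℝ => x i :=
  reindex _ (fun _ => i) fun _ => rfl

@[fun_prop]
theorem pi {f : E → ι → ℝ} (hf : ∀ i, DefFun L fun x => f x i) : DefFun L f :=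
  (DefPred.forall_finite fun i => DefPred.reindex (hf i) (fun p : E × (ι → ℝ) => (p.1, p.2 i))
    (Sum.elim Sum.inl (fun _ => Sum.inr i)) fun p => by ext (j | j) <;> rfl).congr
    fun _ => funext_iff

end DefFun

theorem DefPred.eq {f g : E → F} (hf : DefFun L f) (hg : DefFun L g) :
    DefPred L fun x => f x = g x :=
  DefPred.comp (P := fun p : E × F => p.2 = f p.1) hf (f := fun x => (x, g x)) (by fun_prop)
    |>.congr fun _ => eq_comm

end

section
variable {L : FirstOrder.Language} [L.Structure ℝ]
variable {E F G H : Type} [Coord E] [Coord F] [Coord G] [Coord H] {ι : Type} [Finite ι]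

theorem DefPred.ite {P : E → Prop} [DecidablePred P] {f g : E → F} (hP : DefPred L P)
    (hf : DefFun L f) (hg : DefFun L g) : DefFun L fun x => if P x then f x else g x := by
  refine ((hP.comp_fst.and hf).or (hP.comp_fst.not.and hg)).congr fun p => ?_
  by_cases h : P p.1 <;> simp [h]

theorem DefFun.coordinate (i : Coord.Index E) : DefFun L fun x : E => Coord.equiv x i :=
  DefFun.reindex _ (fun _ => i) fun _ => rfl

theorem DefFun.const_real (c : ℝ) : DefFun L fun _ : E => c :=
  DefPred.comp (P := fun x : Fin 1 → ℝ => x 0 ∈ ({c} : Set ℝ)) (f := fun p : E × ℝ => fun _ => p.2)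
    (Set.Definable.singleton_of_mem L (mem_univ c)) (by fun_prop)

@[fun_prop]
theorem DefFun.const (c : F) : DefFun L fun _ : E => c := by
  refine (DefPred.forall_finite fun i : Coord.Index F =>
    DefPred.eq (f := fun p : E × F => Coord.equiv p.2 i) (g := fun _ => Coord.equiv c i)
      ((DefFun.coordinate i).comp DefFun.snd') (DefFun.const_real _)).congr fun p => ?_
  rw [← Coord.equiv.injective.eq_iff, funext_iff]

variable [LocallyOMinimalField L]

theorem DefPred.lt {f g : E → ℝ} (hf : DefFun L f := by fun_prop) (hg : DefFun L g := by fun_prop) :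
    DefPred L fun x => f x < g x :=
  DefPred.comp (P := fun x : Fin 2 → ℝ => x 0 < x 1) (f := fun x => ![f x, g x])
    LocallyOMinimalField.field.1
    (DefFun.pi fun i => by fin_cases i <;> assumption)

theorem DefPred.le {f g : E → ℝ} (hf : DefFun L f := by fun_prop) (hg : DefFun L g := by fun_prop) :
    DefPred L fun x => f x ≤ g x :=
  (DefPred.lt hg hf).not.congr fun _ => not_lt.symm

@[fun_prop]
theorem DefFun.add {f g : E → ℝ} (hf : DefFun L f) (hg : DefFun L g) :
    DefFun L fun x => f x + g x :=
  (DefPred.comp (P := fun x : Fin 3 → ℝ => x 0 + x 1 = x 2)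
    (f := fun p : E × ℝ => ![f p.1, g p.1, p.2]) LocallyOMinimalField.field.2.1
    (DefFun.pi fun i => by fin_cases i <;> simp <;> fun_prop)).congr
    fun _ => eq_comm

@[fun_prop]
theorem DefFun.mul {f g : E → ℝ} (hf : DefFun L f) (hg : DefFun L g) :
    DefFun L fun x => f x * g x :=
  (DefPred.comp (P := fun x : Fin 3 → ℝ => x 0 * x 1 = x 2)
    (f := fun p : E × ℝ => ![f p.1, g p.1, p.2]) LocallyOMinimalField.field.2.2.1
    (DefFun.pi fun i => by fin_cases i <;> simp <;> fun_prop)).congr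
    fun _ => eq_comm

@[fun_prop]
theorem DefFun.neg {f : E → ℝ} (hf : DefFun L f) : DefFun L fun x => -f x :=
  (show DefFun L fun x => (-1) * f x by fun_prop).congr fun _ => by simp

@[fun_prop]
theorem DefFun.sub {f g : E → ℝ} (hf : DefFun L f) (hg : DefFun L g) :
    DefFun L fun x => f x - g x := by
  simp only [sub_eq_add_neg]
  fun_prop

@[fun_prop]
theorem DefFun.inv {f : E → ℝ} (hf : DefFun L f) : DefFun L fun x => (f x)⁻¹ := by
  refine ((DefPred.eq (f := fun p : E × ℝ => p.2 * f p.1) (g := fun _ => 1) (by fun_prop)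
    (by fun_prop)).or ((DefPred.eq (f := fun p : E × ℝ => f p.1) (g := fun _ => 0)
    (by fun_prop) (by fun_prop)).and (DefPred.eq (f := fun p : E × ℝ => p.2) (g := fun _ => 0)
    (by fun_prop) (by fun_prop)))).congr fun p => ?_
  by_cases h : f p.1 = 0
  · simp [h]
  · simp [h, ← eq_div_iff h]

@[fun_prop]
theorem DefFun.div {f g : E → ℝ} (hf : DefFun L f) (hg : DefFun L g) :
    DefFun L fun x => f x / g x := by
  simp only [div_eq_mul_inv]
  fun_prop

@[fun_prop]
theorem DefFun.pow {f : E → ℝ} (n : ℕ) (hf : DefFun L f) : DefFun L fun x => f x ^ n := by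
  induction n with
  | zero => simp only [pow_zero]; fun_prop
  | succ n ih => simp only [pow_succ]; fun_prop

@[fun_prop]
theorem DefFun.max {f g : E → ℝ} (hf : DefFun L f) (hg : DefFun L g) :
    DefFun L fun x => max (f x) (g x) := by
  simp only [max_def]
  exact (DefPred.le hf hg).ite hg hf

@[fun_prop]
theorem DefFun.abs {f : E → ℝ} (hf : DefFun L f) : DefFun L fun x => |f x| := by
  simp only [abs_eq_max_neg]
  fun_prop

@[fun_prop]
theorem DefFun.sum {κ : Type} (s : Finset κ) {f : κ → E → ℝ} (hf : ∀ k, DefFun L (f k)) :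
    DefFun L fun x => ∑ k ∈ s, f k x := by
  classical
  induction s using Finset.induction_on with
  | empty => simp only [Finset.sum_empty]; fun_prop
  | insert a s ha ih => simp only [Finset.sum_insert ha]; fun_prop

theorem DefFun.csInf {P : E → ℝ → Prop} (h : DefPred L fun p : E × ℝ => P p.1 p.2) :
    DefFun L fun x => sInf {t | P x t} := by
  have hlow : DefPred L fun p : E × ℝ => ∀ t, P p.1 t → p.2 ≤ t :=
    DefPred.all (DefPred.imp (h.comp (f := fun q : (E × ℝ) × ℝ => (q.1.1, q.2)) (by fun_prop))
      DefPred.le)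
  have hmax : DefPred L fun p : E × ℝ => ∀ z, (∀ t, P p.1 t → z ≤ t) → z ≤ p.2 :=
    DefPred.all (DefPred.imp
      (hlow.comp (f := fun q : (E × ℝ) × ℝ => (q.1.1, q.2)) (by fun_prop)) DefPred.le)
  have hA : DefPred L fun x : E => (∃ t, P x t) ∧ ∃ z, ∀ t, P x t → z ≤ t :=
    (DefPred.ex h).and (DefPred.ex hlow)
  refine ((hA.comp_fst.and (hlow.and hmax)).or
    (hA.comp_fst.not.and (DefPred.eq (f := fun p : E × ℝ => p.2) (g := fun _ => 0)
      (by fun_prop) (by fun_prop)))).congr fun p => ?_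
  by_cases hp : (∃ t, P p.1 t) ∧ ∃ z, ∀ t, P p.1 t → z ≤ t
  · have hglb : IsGLB {t | P p.1 t} (sInf {t | P p.1 t}) := isGLB_csInf hp.1 hp.2
    simp only [hp, true_and, not_true, false_and, or_false]
    constructor
    · intro he
      rw [he]
      exact ⟨fun t ht => hglb.1 ht, fun z hz => hglb.2 hz⟩
    · intro he
      exact IsGLB.unique ⟨he.1, he.2⟩ hglb
  · simp only [hp, false_and, not_false_iff, true_and, false_or]
    rw [show sInf {t | P p.1 t} = 0 from ?_]
    rcases not_and_or.1 hp with hp | hp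
    · rw [show {t | P p.1 t} = ∅ from eq_empty_of_forall_notMem fun t ht => hp ⟨t, ht⟩,
        Real.sInf_empty]
    · exact Real.sInf_of_not_bddBelow hp

theorem DefFun.csSup {P : E → ℝ → Prop} (h : DefPred L fun p : E × ℝ => P p.1 p.2) :
    DefFun L fun x => sSup {t | P x t} := by
  have := DefFun.csInf (P := fun x t => P x (-t))
    (h.comp (f := fun q : E × ℝ => (q.1, -q.2)) (by fun_prop))
  have := this.neg
  simpa only [Real.sInf_def, neg_neg, show ∀ x, -{t | P x (-t)} = {t | P x t} from
    fun x => by ext t; simp] using this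

@[fun_prop]
theorem DefFun.dist_pi {ι : Type} [Fintype ι] {f g : E → ι → ℝ} (hf : DefFun L f)
    (hg : DefFun L g) : DefFun L fun x => dist (f x) (g x) := by
  have := DefFun.csInf (L := L) (P := fun x t => 0 ≤ t ∧ ∀ i, |f x i - g x i| ≤ t)
    (DefPred.and DefPred.le (DefPred.forall_finite fun i => DefPred.le))
  convert this using 2 with x
  refine (IsLeast.csInf_eq (s := {t : ℝ | 0 ≤ t ∧ ∀ i, |f x i - g x i| ≤ t})
    ⟨⟨dist_nonneg, fun i => dist_le_pi_dist (f x) (g x) i⟩, ?_⟩).symm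
  rintro t ⟨ht, h⟩
  exact (dist_pi_le_iff ht).2 h

theorem DefPred.eventually_nhds {ι : Type} [Fintype ι] {P : E → (ι → ℝ) → Prop} {f : E → ι → ℝ}
    (h : DefPred L fun p : E × (ι → ℝ) => P p.1 p.2) (hf : DefFun L f := by fun_prop) :
    DefPred L fun x => ∀ᶠ y in 𝓝 (f x), P x y := by
  have : DefPred L fun x => ∃ ε : ℝ, 0 < ε ∧ ∀ y, dist y (f x) < ε → P x y :=
    DefPred.ex (DefPred.and DefPred.lt (DefPred.all (DefPred.imp DefPred.lt
      (h.comp (f := fun q : (E × ℝ) × (ι → ℝ) => (q.1.1, q.2)) (by fun_prop)))))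
  exact this.congr fun x => Metric.eventually_nhds_iff

theorem DefPred.interior {ι : Type} [Fintype ι] {s : Set (ι → ℝ)} (h : DefPred L (· ∈ s)) :
    DefPred L (· ∈ interior s) :=
  (DefPred.eventually_nhds (P := fun _ y => y ∈ s) (f := fun x : ι → ℝ => x) h.comp_snd).congr
    fun _ => mem_interior_iff_mem_nhds

theorem DefPred.closure {ι : Type} [Fintype ι] {s : Set (ι → ℝ)} (h : DefPred L (· ∈ s)) :
    DefPred L (· ∈ closure s) :=
  (DefPred.interior (s := sᶜ) h.not).not.congr fun _ => by simp [interior_compl]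

theorem DefPred.continuousAt {ι : Type} [Fintype ι] {f : (ι → ℝ) → ℝ} (hf : DefFun L f) :
    DefPred L fun x => ContinuousAt f x := by
  have : DefPred L fun x => ∀ ε : ℝ, 0 < ε → ∀ᶠ y in 𝓝 x, |f y - f x| < ε :=
    DefPred.all (DefPred.imp DefPred.lt (DefPred.eventually_nhds DefPred.lt))
  exact this.congr fun x => Metric.tendsto_nhds

/-- The line derivative, as a definable function. -/
theorem DefPred.hasLineDerivAt {ι : Type} [Fintype ι] {f : (ι → ℝ) → ℝ} (hf : DefFun L f)
    (v : ι → ℝ) :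
    DefPred L fun p : (ι → ℝ) × ℝ => HasLineDerivAt ℝ f p.2 p.1 v := by
  have : DefPred L fun p : (ι → ℝ) × ℝ => ∀ ε : ℝ, 0 < ε → ∃ δ : ℝ, 0 < δ ∧ ∀ t : ℝ, |t| < δ →
      |f (fun i => p.1 i + t * v i) - f p.1 - t * p.2| ≤ ε * |t| :=
    DefPred.all (DefPred.imp DefPred.lt (DefPred.ex (DefPred.and DefPred.lt (DefPred.all
      (DefPred.imp DefPred.lt DefPred.le)))))
  refine this.congr fun p => ?_
  rw [HasLineDerivAt, hasDerivAt_iff_isLittleO_nhds_zero, Asymptotics.isLittleO_iff]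
  refine forall₂_congr fun ε hε => ?_
  rw [Metric.eventually_nhds_iff]
  simp [Pi.add_def]

theorem DefPred.lineDifferentiableAt {ι : Type} [Fintype ι] {f : (ι → ℝ) → ℝ} (hf : DefFun L f)
    (v : ι → ℝ) : DefPred L fun x => LineDifferentiableAt ℝ f x v :=
  (DefPred.ex (P := fun x t => HasLineDerivAt ℝ f t x v) (DefPred.hasLineDerivAt hf v)).congr
    fun _ => ⟨fun h => ⟨_, h.hasLineDerivAt⟩, fun ⟨_, h⟩ => h.lineDifferentiableAt⟩

theorem DefFun.lineDeriv {ι : Type} [Fintype ι] {f : (ι → ℝ) → ℝ} (hf : DefFun L f)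
    (v : ι → ℝ) : DefFun L fun x => lineDeriv ℝ f x v := by
  refine ((DefPred.hasLineDerivAt hf v).or ((DefPred.lineDifferentiableAt hf v).comp_fst.not.and
    (DefPred.eq (f := fun p : (ι → ℝ) × ℝ => p.2) (g := fun _ => 0)
      (by fun_prop) (by fun_prop)))).congr fun p => ?_
  by_cases h : LineDifferentiableAt ℝ f p.1 v
  · simp only [h, not_true, false_and, or_false]
    exact ⟨fun e => e ▸ h.hasLineDerivAt, fun e => e.lineDeriv.symm⟩
  · have h' : ∀ t, ¬ HasLineDerivAt ℝ f t p.1 v := fun t ht => h ht.lineDifferentiableAt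
    simp [h, h', lineDeriv_zero_of_not_lineDifferentiableAt h]

end

section
variable {L : FirstOrder.Language} [L.Structure ℝ]
variable {E F : Type} [Coord E] [Coord F]

/-- Definable sets with empty interior are nowhere dense. -/
def DefinablyBaire (L : FirstOrder.Language) [L.Structure ℝ] (E : Type) [Coord E]
    [TopologicalSpace E] : Prop :=
  ∀ X : Set E, DefPred L (· ∈ X) → interior X = ∅ → interior (closure X) = ∅

theorem interior_diff_interior_self {X : Type*} [TopologicalSpace X] (s : Set X) :
    interior (s \ interior s) = ∅ := by
  refine eq_empty_of_forall_notMem fun x hx => ?_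
  exact (interior_subset hx).2 (interior_mono sdiff_subset hx)

theorem DefinablyBaire.exists_interior [TopologicalSpace E] [BaireSpace E]
    (hE : DefinablyBaire L E) (hinter : ∀ X : Set E, DefPred L (· ∈ X) → DefPred L (· ∈ interior X))
    {κ : Type} [Countable κ] {S : κ → Set E} (hS : ∀ k, DefPred L (· ∈ S k)) {O : Set E}
    (hO : IsOpen O) (hne : O.Nonempty) (hcov : O ⊆ ⋃ k, S k) :
    ∃ k, (O ∩ interior (S k)).Nonempty := by
  by_contra! hcon
  have hd : Dense (⋂ k, (closure (S k \ interior (S k)))ᶜ) := by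
    refine dense_iInter_of_isOpen (fun k => isClosed_closure.isOpen_compl) fun k => ?_
    rw [← interior_eq_empty_iff_dense_compl]
    exact hE _ ((hS k).and (hinter _ (hS k)).not) (interior_diff_interior_self _)
  obtain ⟨x, hxO, hx⟩ := hd.inter_open_nonempty O hO hne
  obtain ⟨k, hk⟩ := mem_iUnion.1 (hcov hxO)
  refine mem_iInter.1 hx k (subset_closure ⟨hk, fun hi => ?_⟩)
  exact (hcon k).subset ⟨hxO, hi⟩

theorem DefinablyBaire.homeomorph [TopologicalSpace E] [TopologicalSpace F] (h : E ≃ₜ F)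
    (hh : DefFun L h) (hE : DefinablyBaire L E) : DefinablyBaire L F := by
  intro X hX hXi
  have := hE (h ⁻¹' X) (hX.comp hh) (by rw [← h.preimage_interior, hXi, preimage_empty])
  rw [← h.preimage_closure, ← h.preimage_interior] at this
  simpa using congr_arg (h '' ·) this

variable [LocallyOMinimalField L]

/-- Local o-minimality, phrased with one-sided germs. -/
theorem DefPred.eventually_right_or {P : ℝ → Prop} (hP : DefPred L P) (a : ℝ) :
    (∀ᶠ y in 𝓝[>] a, P y) ∨ ∀ᶠ y in 𝓝[>] a, ¬ P y := by
  obtain ⟨b, c, hb, hc, S, J, h⟩ := LocallyOMinimalField.lomin (L := L) {y | P y}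
    (hP.comp (f := fun x : Fin 1 → ℝ => x 0) (by fun_prop)) a
  set T : Finset ℝ := S ∪ J.image Prod.fst ∪ J.image Prod.snd
  have hT : (↑(T.erase a) : Set ℝ)ᶜ ∈ 𝓝 a :=
    (Finset.finite_toSet _).isClosed.isOpen_compl.mem_nhds (by simp)
  obtain ⟨e, hae, he⟩ := mem_nhdsGT_iff_exists_Ioo_subset.1
    (mem_nhdsWithin_of_mem_nhds (Filter.inter_mem hT (Iio_mem_nhds hc)))
  have hae' : a < e := hae
  have key : ∀ y ∈ Ioo a e, ∀ z ∈ Ioo a e, P y → P z := by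
    intro y hy z hz hPy
    have hy' : y ∈ {y | P y} ∩ Ioo b c := ⟨hPy, hb.trans hy.1, (he hy).2⟩
    have hnot : ∀ w ∈ Ioo a e, w ∉ T := fun w hw hwT =>
      (he hw).1 (by simpa using ⟨hwT, hw.1.ne'⟩)
    rw [h] at hy'
    suffices z ∈ {y | P y} ∩ Ioo b c from this.1
    rw [h]
    rcases hy' with hy' | hy'
    · exact absurd (by simp only [T, Finset.mem_union]; exact Or.inl (Or.inl hy')) (hnot y hy)
    · right
      simp only [mem_iUnion, mem_Ioo] at hy' ⊢
      obtain ⟨p, hp, h1, h2⟩ := hy'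
      have hp1 : p.1 ∈ T := by
        simp only [T, Finset.mem_union, Finset.mem_image]; exact Or.inl (Or.inr ⟨p, hp, rfl⟩)
      have hp2 : p.2 ∈ T := by
        simp only [T, Finset.mem_union, Finset.mem_image]; exact Or.inr ⟨p, hp, rfl⟩
      refine ⟨p, hp, ?_, ?_⟩
      · by_contra hcon
        exact hnot p.1 ⟨hz.1.trans_le (not_lt.1 hcon), h1.trans hy.2⟩ hp1
      · by_contra hcon
        exact hnot p.2 ⟨hy.1.trans h2, (not_lt.1 hcon).trans_lt hz.2⟩ hp2
  have hIoo : Ioo a e ∈ 𝓝[>] a := Ioo_mem_nhdsGT hae'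
  by_cases hex : ∃ y ∈ Ioo a e, P y
  · obtain ⟨y, hy, hPy⟩ := hex
    left
    filter_upwards [hIoo] with z hz using key y hy z hz hPy
  · right
    filter_upwards [hIoo] with z hz hPz using hex ⟨z, hz, hPz⟩

theorem DefPred.eventually_left_or {P : ℝ → Prop} (hP : DefPred L P) (a : ℝ) :
    (∀ᶠ y in 𝓝[<] a, P y) ∨ ∀ᶠ y in 𝓝[<] a, ¬ P y := by
  have h := DefPred.eventually_right_or (L := L) (P := fun y => P (-y))
    (hP.comp (f := fun y : ℝ => -y) (by fun_prop)) (-a)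
  refine h.imp (fun H => ?_) fun H => ?_
  · filter_upwards [tendsto_neg_nhdsLT.eventually H] with y hy
    simpa using hy
  · filter_upwards [tendsto_neg_nhdsLT.eventually H] with y hy
    simpa using hy

theorem DefPred.exists_rat_interval {P : ℝ → Prop} (hP : DefPred L P) {a b : ℝ} (hab : a < b) :
    ∃ p q : ℚ, a < p ∧ p < q ∧ q < b ∧
      ((∀ y ∈ Ioo (p : ℝ) q, P y) ∨ ∀ y ∈ Ioo (p : ℝ) q, ¬ P y) := by
  have aux : ∀ Q : ℝ → Prop, (∀ᶠ y in 𝓝[>] a, Q y) →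
      ∃ p q : ℚ, a < p ∧ p < q ∧ q < b ∧ ∀ y ∈ Ioo (p : ℝ) q, Q y := by
    intro Q hQ
    obtain ⟨e, hae, he⟩ := mem_nhdsGT_iff_exists_Ioo_subset.1
      (Filter.inter_mem hQ (mem_nhdsWithin_of_mem_nhds (Iio_mem_nhds hab)))
    obtain ⟨p, hp1, hp2⟩ := exists_rat_btwn (show a < e from hae)
    obtain ⟨q, hq1, hq2⟩ := exists_rat_btwn hp2
    exact ⟨p, q, hp1, Rat.cast_lt.1 hq1, (he ⟨hp1.trans hq1, hq2⟩).2,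
      fun y hy => (he ⟨hp1.trans hy.1, hy.2.trans hq2⟩).1⟩
  rcases hP.eventually_right_or a with h | h
  · obtain ⟨p, q, h1, h2, h3, h4⟩ := aux _ h
    exact ⟨p, q, h1, h2, h3, Or.inl h4⟩
  · obtain ⟨p, q, h1, h2, h3, h4⟩ := aux _ h
    exact ⟨p, q, h1, h2, h3, Or.inr h4⟩

theorem DefinablyBaire.prod_real [TopologicalSpace E] [BaireSpace E]
    (hE : DefinablyBaire L E) (hinter : ∀ X : Set E, DefPred L (· ∈ X) → DefPred L (· ∈ interior X)) :
    DefinablyBaire L (E × ℝ) := by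
  intro X hX hXi
  refine eq_empty_of_forall_notMem fun x hx => ?_
  obtain ⟨O, J, hO, hxO, hJ, hxJ, hOJ⟩ := mem_nhds_prod_iff'.1 (mem_interior_iff_mem_nhds.1 hx)
  obtain ⟨a, b, hab, habJ⟩ := mem_nhds_iff_exists_Ioo_subset.1 (hJ.mem_nhds hxJ)
  obtain ⟨k, y, hyO, hy⟩ := hE.exists_interior hinter (κ := {k : Bool × ℚ × ℚ //
      a < k.2.1 ∧ k.2.1 < k.2.2 ∧ k.2.2 < b})
    (S := fun k => {x | ∀ t : ℝ, k.1.2.1 < t ∧ t < k.1.2.2 → ((x, t) ∈ X ↔ k.1.1 = true)})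
    (fun k => DefPred.all (DefPred.imp (DefPred.and DefPred.lt DefPred.lt)
      (DefPred.iff (hX.congr fun _ => Iff.rfl) (DefPred.const _)))) hO ⟨_, hxO⟩ (by
      intro x hxO
      obtain ⟨p, q, h1, h2, h3, h4⟩ := DefPred.exists_rat_interval (L := L)
        (P := fun t => (x, t) ∈ X) (hX.comp (by fun_prop)) (hxJ |> fun _ => hab.1.trans hab.2)
      rw [mem_iUnion]
      rcases h4 with h4 | h4
      · exact ⟨⟨(true, p, q), h1, h2, h3⟩, fun t ht => by simpa using h4 t ht⟩
      · exact ⟨⟨(false, p, q), h1, h2, h3⟩, fun t ht => by simpa using h4 t ht⟩)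
  obtain ⟨⟨s, p, q⟩, h1, h2, h3⟩ := k
  obtain ⟨t, ht1, ht2⟩ := exists_between (Rat.cast_lt (K := ℝ).2 h2)
  have hopen : ∀ z ∈ (O ∩ interior {x | ∀ t : ℝ, p < t ∧ t < q → ((x, t) ∈ X ↔ s = true)}) ×ˢ
      Ioo (p : ℝ) q, (z ∈ X ↔ s = true) := fun z hz => interior_subset hz.1.2 z.2 hz.2
  have hopen' : IsOpen ((O ∩ interior {x | ∀ t : ℝ, p < t ∧ t < q → ((x, t) ∈ X ↔ s = true)}) ×ˢ
      Ioo (p : ℝ) q) := (hO.inter isOpen_interior).prod isOpen_Ioo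
  have hmem : (y, t) ∈ (O ∩ interior {x | ∀ t : ℝ, p < t ∧ t < q → ((x, t) ∈ X ↔ s = true)}) ×ˢ
      Ioo (p : ℝ) q := ⟨⟨hyO, hy⟩, ht1, ht2⟩
  cases s
  · obtain ⟨z, hz1, hz2⟩ := mem_closure_iff.1
      (hOJ ⟨hyO, habJ ⟨h1.trans ht1, ht2.trans h3⟩⟩ : (y, t) ∈ closure X) _ hopen' hmem
    simpa using (hopen z hz1).1 hz2
  · exact hXi.subset (mem_interior.2 ⟨_, fun z hz => (hopen z hz).2 rfl, hopen', hmem⟩)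

theorem definablyBaire_pi (ι : Type) [Finite ι] : DefinablyBaire L (ι → ℝ) := by
  let P : Type → Prop := fun ι => ∀ _ : Finite ι, DefinablyBaire L (ι → ℝ)
  suffices P ι from this _
  refine Finite.induction_empty_option (P := P) ?_ ?_ ?_ ι
  · intro α β e h _
    have : Finite α := Finite.of_equiv _ e.symm
    exact (h this).homeomorph (Homeomorph.piCongrLeft (Y := fun _ => ℝ) e)
      (DefFun.reindex _ e.symm fun x => by
        ext i
        obtain ⟨i, rfl⟩ := e.surjective i
        exact (Equiv.piCongrLeft_apply_apply (fun _ => ℝ) e x i).trans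
          (congr_arg x (e.symm_apply_apply i).symm))
  · intro _ X _ hX
    rw [(isOpen_discrete X).interior_eq] at hX
    simp [hX]
  · intro α _ h _
    let h' : (α → ℝ) × ℝ ≃ₜ (Option α → ℝ) :=
      { toFun := fun p o => o.elim p.2 p.1
        invFun := fun v => (fun a => v (some a), v none)
        left_inv := fun p => rfl
        right_inv := fun v => by ext (_ | _) <;> rfl
        continuous_toFun := continuous_pi fun o => by cases o <;> simp <;> fun_prop
        continuous_invFun := by fun_prop }
    exact ((h inferInstance).prod_real fun X hX => DefPred.interior hX).homeomorph h'
      (DefFun.pi fun o => by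
        rcases o with _ | a
        · exact DefFun.snd'
        · exact (show DefFun L fun p : (α → ℝ) × ℝ => p.1 a by fun_prop))

variable {ι : Type} [Fintype ι]

theorem DefPred.interior_closure_eq_empty {X : Set (ι → ℝ)} (hX : DefPred L (· ∈ X))
    (h : _root_.interior X = ∅) : _root_.interior (_root_.closure X) = ∅ :=
  definablyBaire_pi ι X hX h

theorem exists_inter_interior_nonempty {κ : Type} [Countable κ] {S : κ → Set (ι → ℝ)}
    (hS : ∀ k, DefPred L (· ∈ S k)) {O : Set (ι → ℝ)}
    (hO : IsOpen O) (hne : O.Nonempty) (hcov : O ⊆ ⋃ k, S k) :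
    ∃ k, (O ∩ interior (S k)).Nonempty :=
  (definablyBaire_pi ι).exists_interior (fun _ h => DefPred.interior h) hS hO hne hcov

theorem DefPred.interior_union_eq_empty {X Y : Set (ι → ℝ)} (hX : DefPred L (· ∈ X))
    (h : _root_.interior X = ∅) (h' : _root_.interior Y = ∅) :
    _root_.interior (X ∪ Y) = ∅ := by
  have h1 := DefPred.interior_closure_eq_empty hX h
  refine subset_empty_iff.1 ((interior_mono (union_subset_union_left _ subset_closure)).trans ?_)
  rw [interior_union_isClosed_of_interior_empty isClosed_closure h', h1]

end

section
variable {ι : Type} [Fintype ι]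

theorem HasLineDerivAt.hasDerivAt_shift {E : Type*} [NormedAddCommGroup E] [NormedSpace ℝ E]
    {f : E → ℝ} {c t : ℝ} {p v : E} (h : HasLineDerivAt ℝ f c (p + t • v) v) :
    HasDerivAt (fun s : ℝ => f (p + s • v)) c t := by
  have h1 : HasDerivAt (fun s : ℝ => f (p + t • v + s • v)) c (t - t) := by simpa using! h
  have := h1.comp_sub_const t t
  refine this.congr_of_eventuallyEq (Filter.Eventually.of_forall fun s => ?_)
  simp [add_assoc, ← add_smul]

/-- A function with continuous partial derivatives is differentiable. -/
theorem hasFDerivAt_of_continuousAt_partial [DecidableEq ι] {f : (ι → ℝ) → ℝ}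
    {g : ι → (ι → ℝ) → ℝ} {x : ι → ℝ}
    (hf : ∀ᶠ w in 𝓝 x, ∀ i, HasLineDerivAt ℝ f (g i w) w (Pi.single i 1))
    (hg : ∀ i, ContinuousAt (g i) x) :
    HasFDerivAt f (∑ i, g i x • ContinuousLinearMap.proj (R := ℝ) (φ := fun _ : ι => ℝ) i) x := by
  let tr : Finset ι → (ι → ℝ) → ι → ℝ := fun s h i => if i ∈ s then h i else 0
  have key : ∀ s : Finset ι, (fun h : ι → ℝ => f (x + tr s h) - f x - ∑ i ∈ s, g i x * h i)
      =o[𝓝 0] fun h => h := by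
    intro s
    induction s using Finset.induction_on with
    | empty =>
      have : ∀ h, tr ∅ h = 0 := fun h => by ext i; simp [tr]
      simp [this]
    | insert a s ha ih =>
      suffices H : (fun h : ι → ℝ => f (x + tr (insert a s) h) - f (x + tr s h) - g a x * h a)
          =o[𝓝 0] fun h => h by
        refine (H.add ih).congr_left fun h => ?_
        rw [Finset.sum_insert ha]
        ring
      rw [Asymptotics.isLittleO_iff]
      intro ε hε
      obtain ⟨δ, hδ, hball⟩ := Metric.eventually_nhds_iff.1
        (hf.and (Metric.tendsto_nhds.1 (hg a) ε hε))
      filter_upwards [Metric.ball_mem_nhds (0 : ι → ℝ) hδ] with h hh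
      have hh' : ‖h‖ < δ := by simpa using hh
      have hmem : ∀ t ∈ Icc (-|h a|) |h a|, dist (x + tr s h + t • Pi.single a 1) x < δ := by
        intro t ht
        refine lt_of_le_of_lt ?_ hh'
        rw [dist_eq_norm_sub, show x + tr s h + t • Pi.single a 1 - x
          = tr s h + t • (Pi.single a 1 : ι → ℝ) by abel]
        refine (pi_norm_le_iff_of_nonneg (norm_nonneg _)).2 fun i => ?_
        by_cases hi : i = a
        · subst hi
          simp only [tr, Pi.add_apply, ha, if_false, Pi.smul_apply, Pi.single_eq_same, smul_eq_mul,
            mul_one, zero_add]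
          exact (abs_le.2 ht).trans (norm_le_pi_norm h i)
        · simp only [tr, Pi.add_apply, Pi.smul_apply, Pi.single_eq_of_ne hi, smul_eq_mul,
            mul_zero, add_zero]
          split_ifs
          · exact norm_le_pi_norm h i
          · simp
      have hd : ∀ t ∈ Icc (-|h a|) |h a|, HasDerivWithinAt
          (fun t : ℝ => f (x + tr s h + t • Pi.single a 1) - g a x * t)
          (g a (x + tr s h + t • Pi.single a 1) - g a x) (Icc (-|h a|) |h a|) t := by
        intro t ht
        have h1 := HasLineDerivAt.hasDerivAt_shift ((hball (hmem t ht)).1 a)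
        simpa using! (h1.sub ((hasDerivAt_id t).const_mul (g a x))).hasDerivWithinAt
      have hb := Convex.norm_image_sub_le_of_norm_hasDerivWithin_le hd
        (C := ε) (fun t ht => (hball (hmem t ht)).2.le) (convex_Icc _ _)
        (x := 0) (y := h a) ⟨by simp, by simp⟩ ⟨neg_abs_le _, le_abs_self _⟩
      have h2 : x + tr (insert a s) h = x + tr s h + h a • Pi.single a 1 := by
        ext i
        by_cases hi : i = a
        · subst hi; simp [tr, ha]
        · simp [tr, hi]
      rw [h2]
      have h3 : ‖h a‖ ≤ ‖h‖ := norm_le_pi_norm h a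
      simp only [zero_smul, add_zero, mul_zero, sub_zero] at hb
      calc _ = ‖f (x + tr s h + h a • Pi.single a 1) - g a x * h a - f (x + tr s h)‖ := by
            congr 1; ring
        _ ≤ _ := hb.trans (by gcongr)
  rw [hasFDerivAt_iff_isLittleO_nhds_zero]
  refine (key Finset.univ).congr_left fun h => ?_
  simp [tr]

theorem contDiffAt_succ_iff_lineDeriv [DecidableEq ι] {f : (ι → ℝ) → ℝ} {x : ι → ℝ} (r : ℕ) :
    ContDiffAt ℝ (r + 1 : ℕ) f x ↔
      (∀ᶠ w in 𝓝 x, ∀ i, LineDifferentiableAt ℝ f w (Pi.single i 1)) ∧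
      ∀ i, ContDiffAt ℝ r (fun w => lineDeriv ℝ f w (Pi.single i 1)) x := by
  push_cast
  constructor
  · intro h
    have h1 : ∀ᶠ w in 𝓝 x, DifferentiableAt ℝ f w := by
      filter_upwards [h.eventually (by simp)] with w hw
      exact hw.differentiableAt (by simp)
    refine ⟨h1.mono fun w hw i => hw.lineDifferentiableAt, fun i => ?_⟩
    refine ContDiffAt.congr_of_eventuallyEq (f := fun w => fderiv ℝ f w (Pi.single i 1)) ?_
      (h1.mono fun w hw => hw.lineDeriv_eq_fderiv)
    exact (h.fderiv_right le_rfl).clm_apply contDiffAt_const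
  · rintro ⟨h1, h2⟩
    rw [contDiffAt_succ_iff_hasFDerivAt]
    refine ⟨fun w => ∑ i, lineDeriv ℝ f w (Pi.single i 1) •
      ContinuousLinearMap.proj (R := ℝ) (φ := fun _ : ι => ℝ) i, ?_, ?_⟩
    · have h3 : ∀ᶠ w in 𝓝 x, ∀ i, ContinuousAt (fun w => lineDeriv ℝ f w (Pi.single i 1)) w := by
        rw [Filter.eventually_all]
        intro i
        filter_upwards [(h2 i).eventually (by simp)] with w hw using hw.continuousAt
      refine ⟨_, h1.eventually_nhds.and h3, fun w hw => ?_⟩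
      exact hasFDerivAt_of_continuousAt_partial
        (hw.1.mono fun z hz i => (hz i).hasLineDerivAt) hw.2
    · exact ContDiffAt.sum fun i _ => (h2 i).smul contDiffAt_const

theorem contDiffAt_zero_iff_eventually {E : Type*} [NormedAddCommGroup E] [NormedSpace ℝ E]
    {f : E → ℝ} {x : E} :
    ContDiffAt ℝ 0 f x ↔ ∀ᶠ w in 𝓝 x, ContinuousAt f w := by
  rw [contDiffAt_zero]
  constructor
  · rintro ⟨u, hu, h⟩
    filter_upwards [eventually_mem_nhds_iff.2 hu] with w hw using h.continuousAt hw
  · exact fun h => ⟨_, h, fun w hw => ContinuousAt.continuousWithinAt hw⟩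

theorem monotoneOn_of_eventually_right {g : ℝ → ℝ} {a b : ℝ} (hc : ContinuousOn g (Ioo a b))
    (h : ∀ x ∈ Ioo a b, ∀ᶠ y in 𝓝[>] x, g x ≤ g y) : MonotoneOn g (Ioo a b) := by
  intro c hca d hdb hcd
  have hsub : Icc c d ⊆ Ioo a b := Icc_subset_Ioo hca.1 hdb.2
  have hcl : IsClosed ({y | g c ≤ g y} ∩ Icc c d) := by
    rw [inter_comm]
    exact (hc.mono hsub).preimage_isClosed_of_isClosed isClosed_Icc isClosed_Ici
  refine IsClosed.Icc_subset_of_forall_mem_nhdsWithin hcl (le_refl (g c)) ?_ (right_mem_Icc.2 hcd)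
  rintro x ⟨hx, hxc⟩
  filter_upwards [h x (hsub ⟨hxc.1, hxc.2.le⟩)] with y hy using le_trans hx hy

theorem MonotoneOn.exists_differentiableAt {g : ℝ → ℝ} {a b : ℝ} (hab : a < b)
    (h : MonotoneOn g (Ioo a b)) : ∃ t ∈ Ioo a b, DifferentiableAt ℝ g t := by
  have h1 := h.ae_differentiableWithinAt measurableSet_Ioo
  rw [MeasureTheory.ae_restrict_iff' measurableSet_Ioo] at h1
  by_contra! hcon
  have h2 : ∀ᵐ x, x ∉ Ioo a b := h1.mono fun x hx hxI =>
    hcon x hxI ((hx hxI).differentiableAt (isOpen_Ioo.mem_nhds hxI))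
  have h3 : MeasureTheory.volume (Ioo a b) = 0 := MeasureTheory.measure_eq_zero_iff_ae_notMem.2 h2
  rw [Real.volume_Ioo, ENNReal.ofReal_eq_zero] at h3
  linarith

variable {L : FirstOrder.Language} [L.Structure ℝ] [LocallyOMinimalField L]

theorem DefFun.exists_differentiableAt {g : ℝ → ℝ} (hg : DefFun L g) {a b : ℝ} (hab : a < b)
    (hc : ContinuousOn g (Ioo a b)) : ∃ t ∈ Ioo a b, DifferentiableAt ℝ g t := by
  have hdef : DefPred L fun x : ℝ => ∃ e : ℝ, x < e ∧ ∀ y : ℝ, x < y ∧ y < e → g x ≤ g y :=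
    DefPred.ex (DefPred.and DefPred.lt (DefPred.all (DefPred.imp
      (DefPred.and DefPred.lt DefPred.lt) DefPred.le)))
  have hS : DefPred L fun x : ℝ => ∀ᶠ y in 𝓝[>] x, g x ≤ g y :=
    hdef.congr fun x => mem_nhdsGT_iff_exists_Ioo_subset
  obtain ⟨p, q, hp, hpq, hq, h | h⟩ := hS.exists_rat_interval hab
  · obtain ⟨t, ht, h'⟩ := MonotoneOn.exists_differentiableAt (Rat.cast_lt.2 hpq)
      (monotoneOn_of_eventually_right (hc.mono (Ioo_subset_Ioo hp.le hq.le)) h)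
    exact ⟨t, Ioo_subset_Ioo hp.le hq.le ht, h'⟩
  · obtain ⟨t, ht, h'⟩ := MonotoneOn.exists_differentiableAt (g := fun x => -g x)
      (Rat.cast_lt.2 hpq)
      (monotoneOn_of_eventually_right (hc.neg.mono (Ioo_subset_Ioo hp.le hq.le)) fun x hx => by
        rcases DefPred.eventually_right_or (L := L) (P := fun y => g x ≤ g y) DefPred.le x with H | H
        · exact absurd H (h x hx)
        · filter_upwards [H] with y hy
          linarith)
    refine ⟨t, Ioo_subset_Ioo hp.le hq.le ht, ?_⟩
    simpa using h'.neg

theorem DefPred.finite_of_subset_Icc {Y : Set ℝ} (hY : DefPred L (· ∈ Y)) {a b : ℝ}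
    (hab : Y ⊆ Icc a b) (h : _root_.interior Y = ∅) : Y.Finite := by
  by_contra hinf
  obtain ⟨x, -, hx⟩ := Set.Infinite.exists_accPt_of_subset_isCompact hinf isCompact_Icc hab
  have fin : ∀ p q : ℝ, p < q → ¬ Ioo p q ⊆ Y := fun p q hpq hsub => by
    have := interior_maximal hsub isOpen_Ioo
    rw [h] at this
    obtain ⟨z, hz⟩ := nonempty_Ioo.2 hpq
    exact this hz
  rw [accPt_iff_frequently_nhdsNE, ← nhdsLT_sup_nhdsGT, Filter.frequently_sup] at hx
  rcases hx with hx | hx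
  · rcases hY.eventually_left_or x with H | H
    · obtain ⟨e, he, hsub⟩ := mem_nhdsLT_iff_exists_Ioo_subset.1 H
      exact fin e x he hsub
    · exact hx H
  · rcases hY.eventually_right_or x with H | H
    · obtain ⟨e, he, hsub⟩ := mem_nhdsGT_iff_exists_Ioo_subset.1 H
      exact fin x e he hsub
    · exact hx H

/-- Infinite definable subsets of the line have interior. -/
theorem DefPred.finite_of_interior_eq_empty {Y : Set ℝ} (hY : DefPred L (· ∈ Y))
    (h : _root_.interior Y = ∅) : Y.Finite := by
  have h1 : (Y ∩ Icc (-1) 1).Finite :=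
    DefPred.finite_of_subset_Icc (L := L) (hY.and (DefPred.and DefPred.le DefPred.le))
      inter_subset_right (subset_empty_iff.1 ((interior_mono inter_subset_left).trans h.subset))
  have h2 : ({t : ℝ | t⁻¹ ∈ Y} ∩ Icc (-1) 1).Finite := by
    refine DefPred.finite_of_subset_Icc (L := L)
      ((hY.comp (f := fun t : ℝ => t⁻¹) (by fun_prop)).and (DefPred.and DefPred.le DefPred.le))
      inter_subset_right ?_
    by_contra hne
    obtain ⟨t, ht, ht0⟩ := (dense_compl_singleton (0 : ℝ)).inter_open_nonempty _ isOpen_interior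
      (nonempty_iff_ne_empty.2 hne)
    have ho : IsOpen ({0}ᶜ ∩ (fun y : ℝ => y⁻¹) ⁻¹'
        _root_.interior ({t : ℝ | t⁻¹ ∈ Y} ∩ Icc (-1) 1)) :=
      continuousOn_inv₀.isOpen_inter_preimage isOpen_compl_singleton isOpen_interior
    have hmem : t⁻¹ ∈ _root_.interior Y := by
      refine interior_maximal ?_ ho ⟨by simpa using ht0, by simpa using ht⟩
      rintro y ⟨-, hy⟩
      simpa using (interior_subset hy).1
    rw [h] at hmem
    exact hmem
  refine (h1.union (h2.image fun t => t⁻¹)).subset fun y hy => ?_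
  by_cases hy1 : |y| ≤ 1
  · exact Or.inl ⟨hy, abs_le.1 hy1⟩
  · refine Or.inr ⟨y⁻¹, ⟨by simpa using hy, abs_le.1 ?_⟩, inv_inv y⟩
    rw [abs_inv]
    exact inv_le_one_of_one_le₀ (not_le.1 hy1).le

theorem DefPred.iUnion_interior_eq_empty {κ : Type} [Countable κ] {S : κ → Set (ι → ℝ)}
    (hS : ∀ k, DefPred L (· ∈ S k)) (h : ∀ k, _root_.interior (S k) = ∅) :
    _root_.interior (⋃ k, S k) = ∅ := by
  by_contra hne
  obtain ⟨k, x, -, hx⟩ := exists_inter_interior_nonempty hS isOpen_interior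
    (nonempty_iff_ne_empty.2 hne) interior_subset
  rw [h k] at hx
  exact hx

theorem DefPred.eventually_of_dense {P : (ι → ℝ) → Prop} (hP : DefPred L P)
    (h : ∀ O : Set (ι → ℝ), IsOpen O → O.Nonempty → ∃ x ∈ O, P x) :
    _root_.interior {x | ¬ ∀ᶠ w in 𝓝 x, P w} = ∅ := by
  have h1 : _root_.interior {x | ¬ P x} = ∅ := by
    by_contra hne
    obtain ⟨x, hx, hPx⟩ := h _ isOpen_interior (nonempty_iff_ne_empty.2 hne)
    exact interior_subset hx hPx
  have h2 := DefPred.interior_closure_eq_empty hP.not h1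
  convert h2 using 2
  ext x
  exact Filter.not_eventually.trans mem_closure_iff_frequently.symm

theorem DefFun.eventually_continuousAt {f : (ι → ℝ) → ℝ} (hf : DefFun L f) :
    interior {x | ¬ ∀ᶠ w in 𝓝 x, ContinuousAt f w} = ∅ := by
  refine DefPred.eventually_of_dense (DefPred.continuousAt hf) fun O hO hne => ?_
  let A : ℕ → Set (ι → ℝ) := fun n =>
    ⋃₀ {V | IsOpen V ∧ ∀ y ∈ V, ∀ z ∈ V, |f y - f z| < 1 / ((n : ℝ) + 1)}
  have hA : Dense (⋂ n, A n) := by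
    refine dense_iInter_of_isOpen (fun n => isOpen_sUnion fun V hV => hV.1) fun n => ?_
    rw [dense_iff_inter_open]
    intro O hO hne
    have hn : (0 : ℝ) < n + 1 := by positivity
    obtain ⟨k, x, hxO, hx⟩ := exists_inter_interior_nonempty (L := L) (κ := ℤ)
      (S := fun k => {x | (k : ℝ) ≤ f x * (n + 1) ∧ f x * (n + 1) < k + 1})
      (fun k => DefPred.and DefPred.le DefPred.lt) hO hne
      (fun x _ => mem_iUnion.2 ⟨⌊f x * (n + 1)⌋, Int.floor_le _, Int.lt_floor_add_one _⟩)
    refine ⟨x, hxO, mem_sUnion.2 ⟨_, ⟨isOpen_interior, fun y hy z hz => ?_⟩, hx⟩⟩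
    have hy' := interior_subset hy
    have hz' := interior_subset hz
    rw [lt_div_iff₀ hn, ← abs_of_pos hn, ← abs_mul, abs_lt]
    constructor <;> linarith [hy'.1, hy'.2, hz'.1, hz'.2]
  obtain ⟨x, hxO, hx⟩ := hA.inter_open_nonempty O hO hne
  refine ⟨x, hxO, Metric.tendsto_nhds.2 fun ε hε => ?_⟩
  obtain ⟨n, hn⟩ := exists_nat_one_div_lt hε
  obtain ⟨V, ⟨hV, hVf⟩, hxV⟩ := mem_sUnion.1 (mem_iInter.1 hx n)
  filter_upwards [hV.mem_nhds hxV] with y hy using (hVf y hy x hxV).trans hn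

theorem DefFun.eventually_lineDifferentiableAt {f : (ι → ℝ) → ℝ} (hf : DefFun L f) (v : ι → ℝ) :
    interior {x | ¬ ∀ᶠ w in 𝓝 x, LineDifferentiableAt ℝ f w v} = ∅ := by
  refine DefPred.eventually_of_dense (DefPred.lineDifferentiableAt hf v) fun O hO hne => ?_
  obtain ⟨x, hxO, hx⟩ : ∃ x ∈ O, ∀ᶠ w in 𝓝 x, ContinuousAt f w := by
    by_contra hcon
    have := interior_maximal (s := {x | ¬ ∀ᶠ w in 𝓝 x, ContinuousAt f w})
      (fun x hx h => hcon ⟨x, hx, h⟩) hO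
    rw [hf.eventually_continuousAt] at this
    exact hne.ne_empty (subset_empty_iff.1 this)
  have hline : Continuous fun t : ℝ => x + t • v := by fun_prop
  have h0 : ∀ᶠ t : ℝ in 𝓝 0, x + t • v ∈ O ∧ ContinuousAt f (x + t • v) :=
    hline.continuousAt.eventually (p := fun w => w ∈ O ∧ ContinuousAt f w)
      (by simpa only [zero_smul, add_zero] using (hO.eventually_mem hxO).and hx)
  obtain ⟨δ, hδ, hball⟩ := Metric.eventually_nhds_iff.1 h0
  obtain ⟨t, ht, hd⟩ := DefFun.exists_differentiableAt (L := L) (g := fun t : ℝ => f (x + t • v))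
    (hf.comp (DefFun.pi fun i => show DefFun L fun t : ℝ => x i + t * v i by fun_prop))
    (a := -δ) (b := δ) (by linarith) fun t ht =>
      (ContinuousAt.comp (f := fun t : ℝ => x + t • v)
        (hball (by simpa using abs_lt.2 ht)).2 hline.continuousAt).continuousWithinAt
  refine ⟨x + t • v, (hball (by simpa using abs_lt.2 ht)).1, ?_⟩
  have h1 : DifferentiableAt ℝ (fun s : ℝ => f (x + s • v)) (t + 0) := by simpa using hd
  have h2 := h1.hasDerivAt.comp_const_add t 0
  refine HasLineDerivAt.lineDifferentiableAt (f' := deriv (fun s : ℝ => f (x + s • v)) (t + 0))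
    (h2.congr_of_eventuallyEq (Filter.Eventually.of_forall fun s => ?_))
  simp [add_smul, add_assoc]

theorem DefPred.contDiffAt {f : (ι → ℝ) → ℝ} (hf : DefFun L f) (r : ℕ) :
    DefPred L fun x => ContDiffAt ℝ r f x := by
  classical
  induction r generalizing f with
  | zero =>
    exact (DefPred.eventually_nhds (f := fun x : ι → ℝ => x)
      (DefPred.continuousAt hf).comp_snd).congr fun x => contDiffAt_zero_iff_eventually
  | succ r ih =>
    exact (DefPred.and (DefPred.eventually_nhds (f := fun x : ι → ℝ => x)
      (DefPred.forall_finite fun i => DefPred.lineDifferentiableAt hf (Pi.single i 1)).comp_snd)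
      (DefPred.forall_finite fun i => ih (DefFun.lineDeriv hf (Pi.single i 1)))).congr
      fun x => contDiffAt_succ_iff_lineDeriv r

theorem isOpen_setOf_contDiffAt {E : Type*} [NormedAddCommGroup E] [NormedSpace ℝ E]
    (f : E → ℝ) (r : ℕ) : IsOpen {x | ContDiffAt ℝ r f x} :=
  isOpen_iff_mem_nhds.2 fun _ hx =>
    ContDiffAt.eventually hx (by simp)

/-- Definable functions are generically of class `C^r`. -/
theorem DefFun.interior_not_contDiffAt {f : (ι → ℝ) → ℝ} (hf : DefFun L f) (r : ℕ) :
    interior {x | ¬ ContDiffAt ℝ r f x} = ∅ := by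
  classical
  induction r generalizing f with
  | zero => simpa [contDiffAt_zero_iff_eventually] using hf.eventually_continuousAt
  | succ r ih =>
    have hD : ∀ i, DefPred L fun x : ι → ℝ => ∀ᶠ w in 𝓝 x,
        LineDifferentiableAt ℝ f w (Pi.single (M := fun _ : ι => ℝ) i 1) := fun i =>
      DefPred.eventually_nhds (f := fun x : ι → ℝ => x)
        (DefPred.lineDifferentiableAt hf (Pi.single i 1)).comp_snd
    have h1 : interior (⋃ i, {x | ¬ ∀ᶠ w in 𝓝 x,
        LineDifferentiableAt ℝ f w (Pi.single (M := fun _ : ι => ℝ) i 1)}) = ∅ :=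
      DefPred.iUnion_interior_eq_empty (L := L)
        (fun i => (hD i).not) fun i => hf.eventually_lineDifferentiableAt _
    have h2 : interior (⋃ i, {x | ¬ ContDiffAt ℝ r
        (fun w => _root_.lineDeriv ℝ f w (Pi.single (M := fun _ : ι => ℝ) i 1)) x}) = ∅ :=
      DefPred.iUnion_interior_eq_empty (L := L)
        (fun i => (DefPred.contDiffAt (DefFun.lineDeriv hf (Pi.single i 1)) r).not)
        fun i => ih (DefFun.lineDeriv hf _)
    have h3 := DefPred.interior_union_eq_empty (L := L)
      (X := ⋃ i, {x | ¬ ∀ᶠ w in 𝓝 x,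
        LineDifferentiableAt ℝ f w (Pi.single (M := fun _ : ι => ℝ) i 1)})
      ((DefPred.exists_finite fun i => (hD i).not).congr fun x => mem_iUnion) h1 h2
    convert h3 using 2
    ext x
    simp only [mem_union, mem_iUnion, mem_ofPred_eq, contDiffAt_succ_iff_lineDeriv,
      Filter.eventually_all]
    rw [not_and_or, not_forall, not_forall]

end

section
variable {ι : Type}

/-- Projection to the coordinates in `σ`. -/
def pr (σ : Finset ι) (z : ι → ℝ) : σ → ℝ := fun i => z i

@[fun_prop]
theorem continuous_pr (σ : Finset ι) : Continuous (pr σ) :=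
  continuous_pi fun i => continuous_apply (i : ι)

variable [Fintype ι]

@[fun_prop]
theorem contDiff_pr (σ : Finset ι) (n : WithTop ℕ∞) : ContDiff ℝ n (pr σ) :=
  contDiff_pi.2 fun i => contDiff_apply ℝ ℝ (i : ι)

theorem dist_pr_le (σ : Finset ι) (z w : ι → ℝ) : dist (pr σ z) (pr σ w) ≤ dist z w :=
  (dist_pi_le_iff dist_nonneg).2 fun i => dist_le_pi_dist z w i

/-- The square of the Euclidean distance. -/
def sqDist (z w : ι → ℝ) : ℝ := ∑ i, (z i - w i) ^ 2

theorem sqDist_self (z : ι → ℝ) : sqDist z z = 0 := by simp [sqDist]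

theorem sqDist_nonneg (z w : ι → ℝ) : 0 ≤ sqDist z w := Finset.sum_nonneg fun _ _ => sq_nonneg _

theorem dist_sq_le_sqDist (z w : ι → ℝ) : dist z w ^ 2 ≤ sqDist z w := by
  have h : dist z w ≤ √(sqDist z w) := (dist_pi_le_iff (Real.sqrt_nonneg _)).2 fun i => by
    rw [Real.dist_eq]
    refine Real.abs_le_sqrt ?_
    exact Finset.single_le_sum (f := fun i => (z i - w i) ^ 2) (fun _ _ => sq_nonneg _)
      (Finset.mem_univ i)
  calc _ ≤ √(sqDist z w) ^ 2 := by gcongr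
    _ = _ := Real.sq_sqrt (sqDist_nonneg z w)

theorem sqDist_le (x y z : ι → ℝ) : sqDist x z ≤ 2 * sqDist x y + 2 * sqDist y z := by
  simp only [sqDist, Finset.mul_sum, ← Finset.sum_add_distrib]
  refine Finset.sum_le_sum fun i _ => ?_
  nlinarith [sq_nonneg (x i - y i - (y i - z i))]

theorem contDiff_sqDist (n : WithTop ℕ∞) :
    ContDiff ℝ n fun p : (ι → ℝ) × (ι → ℝ) => sqDist p.1 p.2 :=
  ContDiff.sum fun i _ => ((contDiff_apply ℝ ℝ i).comp contDiff_fst |>.sub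
    ((contDiff_apply ℝ ℝ i).comp contDiff_snd)).pow 2

/-- The sets of coordinates onto which `Z` projects with nonempty interior. -/
noncomputable def fullProjections (Z : Set (ι → ℝ)) : Finset (Finset ι) :=
  open Classical in Finset.univ.filter fun σ => (interior (pr σ '' Z)).Nonempty

theorem mem_fullProjections {Z : Set (ι → ℝ)} {σ : Finset ι} :
    σ ∈ fullProjections Z ↔ (interior (pr σ '' Z)).Nonempty := by
  simp [fullProjections]

theorem fullProjections_mono {Z Z' : Set (ι → ℝ)} (h : Z' ⊆ Z) :
    fullProjections Z' ⊆ fullProjections Z := fun _ hσ =>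
  mem_fullProjections.2 ((mem_fullProjections.1 hσ).mono (interior_mono (image_mono h)))

theorem eq_empty_of_fullProjections {Z : Set (ι → ℝ)} (h : fullProjections Z = ∅) : Z = ∅ := by
  refine eq_empty_of_forall_notMem fun z hz => ?_
  have : ∅ ∈ fullProjections Z := mem_fullProjections.2
    ⟨pr ∅ z, by rw [(isOpen_discrete _).interior_eq]; exact mem_image_of_mem _ hz⟩
  simp [h] at this

theorem card_lt_of_mem_fullProjections {Z : Set (ι → ℝ)} (hZ : interior Z = ∅) {σ : Finset ι}
    (h : σ ∈ fullProjections Z) : Fintype.card σ < Fintype.card ι := by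
  rw [Fintype.card_coe]
  refine (Finset.card_le_univ σ).lt_of_ne fun hcard => ?_
  obtain rfl := (Finset.card_eq_iff_eq_univ σ).1 hcard
  obtain ⟨x, hx⟩ := mem_fullProjections.1 h
  have hinj : Function.Injective (pr (Finset.univ : Finset ι)) := fun z w hzw =>
    funext fun i => congr_fun hzw ⟨i, Finset.mem_univ i⟩
  have h1 := preimage_interior_subset_interior_preimage (t := pr Finset.univ '' Z)
    (continuous_pr Finset.univ)
  rw [hinj.preimage_image, hZ] at h1
  exact h1 (show pr Finset.univ (fun i => x ⟨i, Finset.mem_univ i⟩) ∈ _ from hx)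

/-- The squared distance to `Z` along the fibres of a coordinate projection. -/
noncomputable def fibreDist (σ : Finset ι) (Z : Set (ι → ℝ)) (z : ι → ℝ) : ℝ :=
  sInf {t | ∃ w, (w ∈ Z ∧ pr σ w = pr σ z) ∧ sqDist z w = t}

theorem bddBelow_fibreDist (σ : Finset ι) (Z : Set (ι → ℝ)) (z : ι → ℝ) :
    BddBelow {t | ∃ w, (w ∈ Z ∧ pr σ w = pr σ z) ∧ sqDist z w = t} :=
  ⟨0, by rintro _ ⟨w, -, rfl⟩; exact sqDist_nonneg z w⟩

theorem fibreDist_le {σ : Finset ι} {Z : Set (ι → ℝ)} {z w : ι → ℝ} (hw : w ∈ Z)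
    (h : pr σ w = pr σ z) : fibreDist σ Z z ≤ sqDist z w :=
  csInf_le (bddBelow_fibreDist σ Z z) ⟨w, ⟨hw, h⟩, rfl⟩

theorem fibreDist_nonneg (σ : Finset ι) (Z : Set (ι → ℝ)) (z : ι → ℝ) : 0 ≤ fibreDist σ Z z :=
  Real.sInf_nonneg (by rintro _ ⟨w, -, rfl⟩; exact sqDist_nonneg z w)

theorem exists_of_fibreDist_lt {σ : Finset ι} {Z : Set (ι → ℝ)} {z : ι → ℝ} {ε : ℝ}
    (hz : pr σ z ∈ pr σ '' Z) (h : fibreDist σ Z z < ε) :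
    ∃ w ∈ Z, pr σ w = pr σ z ∧ sqDist z w < ε := by
  obtain ⟨w, hw, hwz⟩ := hz
  have hne : {t | ∃ w, (w ∈ Z ∧ pr σ w = pr σ z) ∧ sqDist z w = t}.Nonempty :=
    ⟨_, w, ⟨hw, hwz⟩, rfl⟩
  obtain ⟨_, ⟨w, hw, rfl⟩, hlt⟩ := exists_lt_of_csInf_lt hne h
  exact ⟨w, hw.1, hw.2, hlt⟩

variable {L : FirstOrder.Language} [L.Structure ℝ]
variable {E : Type} [Coord E]

@[fun_prop]
theorem DefFun.pr {σ : Finset ι} {f : E → ι → ℝ} (hf : DefFun L f) :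
    DefFun L fun x => pr σ (f x) :=
  DefFun.pi fun i => show DefFun L fun x => f x i by fun_prop

theorem DefPred.image {F : Type} [Coord F] {Z : Set E} (hZ : DefPred L (· ∈ Z)) {f : E → F}
    (hf : DefFun L f) : DefPred L (· ∈ f '' Z) :=
  DefPred.ex (DefPred.and hZ.comp_snd (DefPred.eq (hf.comp DefFun.snd') DefFun.fst'))

variable [LocallyOMinimalField L]

@[fun_prop]
theorem DefFun.sqDist {f g : E → ι → ℝ} (hf : DefFun L f) (hg : DefFun L g) :
    DefFun L fun x => sqDist (f x) (g x) :=
  DefFun.sum _ fun i => by fun_prop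

theorem DefFun.fibreDist {σ : Finset ι} {Z : Set (ι → ℝ)} (hZ : DefPred L (· ∈ Z)) :
    DefFun L (fibreDist σ Z) :=
  DefFun.csInf (DefPred.ex (DefPred.and (DefPred.and hZ.comp_snd
    (DefPred.eq (by fun_prop) (by fun_prop))) (DefPred.eq (by fun_prop) (by fun_prop))))

/-- The points over which the fibre of `Z` contains an interval in direction `j`. -/
def wideFibres (σ : Finset ι) (Z : Set (ι → ℝ)) (j : ι) : Set (σ → ℝ) :=
  {x | ∃ p q : ℝ, p < q ∧ ∀ t, p < t ∧ t < q → ∃ z, z ∈ Z ∧ pr σ z = x ∧ z j = t}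

theorem DefPred.wideFibres {σ : Finset ι} {Z : Set (ι → ℝ)} (hZ : DefPred L (· ∈ Z)) (j : ι) :
    DefPred L (· ∈ wideFibres σ Z j) :=
  DefPred.ex (DefPred.ex (DefPred.and DefPred.lt (DefPred.all (DefPred.imp
    (DefPred.and DefPred.lt DefPred.lt) (DefPred.ex (DefPred.and hZ.comp_snd (DefPred.and
      (DefPred.eq (by fun_prop) (by fun_prop)) (DefPred.eq (by fun_prop) (by fun_prop)))))))))

theorem DefPred.interior_wideFibres {σ : Finset ι} {Z : Set (ι → ℝ)} (hZ : DefPred L (· ∈ Z))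
    (hσ : ∀ τ ∈ fullProjections Z, ¬ σ ⊂ τ) (j : ι) :
    _root_.interior (Paper.wideFibres σ Z j) = ∅ := by
  classical
  by_cases hj : j ∈ σ
  · refine subset_empty_iff.1 (interior_subset.trans ?_)
    rintro x ⟨p, q, hpq, h⟩
    obtain ⟨s, hs1, hs2⟩ := exists_between hpq
    obtain ⟨t, ht1, ht2⟩ := exists_between hs2
    obtain ⟨z, -, hz, hzs⟩ := h s ⟨hs1, hs2⟩
    obtain ⟨w, -, hw, hwt⟩ := h t ⟨hs1.trans ht1, ht2⟩
    have := congr_fun (hz.trans hw.symm) ⟨j, hj⟩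
    simp only [Paper.pr] at this
    linarith
  · by_contra hne
    obtain ⟨⟨p, q⟩, x, hx⟩ := exists_inter_interior_nonempty (L := L) (κ := ℚ × ℚ)
      (S := fun k => {x | (k.1 : ℝ) < k.2 ∧ ∀ t, (k.1 : ℝ) < t ∧ t < k.2 →
        ∃ z, z ∈ Z ∧ Paper.pr σ z = x ∧ z j = t})
      (fun k => DefPred.and DefPred.lt (DefPred.all (DefPred.imp
        (DefPred.and DefPred.lt DefPred.lt) (DefPred.ex (DefPred.and hZ.comp_snd (DefPred.and
        (DefPred.eq (by fun_prop) (by fun_prop)) (DefPred.eq (by fun_prop) (by fun_prop))))))))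
      isOpen_interior (nonempty_iff_ne_empty.2 hne) (by
        intro x hx
        obtain ⟨p, q, hpq, h⟩ := interior_subset hx
        obtain ⟨p', h1, h2⟩ := exists_rat_btwn hpq
        obtain ⟨q', h3, h4⟩ := exists_rat_btwn h2
        exact mem_iUnion.2 ⟨(p', q'), h3, fun t ht => h t ⟨h1.trans ht.1, ht.2.trans h4⟩⟩)
    have hx' := hx.2
    set S := {x | (p : ℝ) < q ∧ ∀ t, (p : ℝ) < t ∧ t < q →
        ∃ z, z ∈ Z ∧ Paper.pr σ z = x ∧ z j = t} with hS
    have hxS : x ∈ S := interior_subset hx'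
    refine hσ (insert j σ) (mem_fullProjections.2 ?_) (Finset.ssubset_insert hj)
    let r : ({i // i ∈ insert j σ} → ℝ) → {i // i ∈ σ} → ℝ :=
      fun y i => y ⟨i.1, Finset.mem_insert_of_mem i.2⟩
    have hr : Continuous r := continuous_pi fun i => continuous_apply _
    let e : ({i // i ∈ insert j σ} → ℝ) → ℝ := fun y => y ⟨j, Finset.mem_insert_self j σ⟩
    have he : Continuous e := continuous_apply _
    obtain ⟨t, ht⟩ := exists_between hxS.1
    obtain ⟨z, hz, rfl, rfl⟩ := hxS.2 t ht
    refine ⟨Paper.pr _ z, mem_interior.2 ⟨r ⁻¹' _root_.interior S ∩ e ⁻¹' Ioo (p : ℝ) q, ?_,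
      (isOpen_interior.preimage hr).inter (isOpen_Ioo.preimage he), hx', ht⟩⟩
    rintro y ⟨hy1, hy2⟩
    obtain ⟨w, hw, hw1, hw2⟩ := (interior_subset hy1).2 _ hy2
    refine ⟨w, hw, ?_⟩
    ext ⟨i, hi⟩
    rcases Finset.mem_insert.1 hi with rfl | hi'
    · exact hw2
    · exact congr_fun hw1 ⟨i, hi'⟩

theorem DefPred.finite_fibre {σ : Finset ι} {Z : Set (ι → ℝ)} (hZ : DefPred L (· ∈ Z))
    {x : σ → ℝ} (hx : x ∉ ⋃ j, Paper.wideFibres σ Z j) : {z | z ∈ Z ∧ Paper.pr σ z = x}.Finite := by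
  have h : ∀ j, ((fun z : ι → ℝ => z j) '' {z | z ∈ Z ∧ Paper.pr σ z = x}).Finite := by
    intro j
    refine DefPred.finite_of_interior_eq_empty (L := L) (DefPred.image (DefPred.and hZ
      (DefPred.eq (by fun_prop) (by fun_prop))) (by fun_prop)) ?_
    refine eq_empty_of_forall_notMem fun t ht => hx (mem_iUnion.2 ⟨j, ?_⟩)
    obtain ⟨p, q, hpq, hsub⟩ := mem_nhds_iff_exists_Ioo_subset.1 (mem_interior_iff_mem_nhds.1 ht)
    refine ⟨p, q, hpq.1.trans hpq.2, fun s hs => ?_⟩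
    obtain ⟨z, hz, hzs⟩ := hsub hs
    exact ⟨z, hz.1, hz.2, hzs⟩
  exact (Set.Finite.pi' h).subset fun z hz j => ⟨z, hz, rfl⟩

end

section
variable {L : FirstOrder.Language} [L.Structure ℝ] [LocallyOMinimalField L]
variable {ι : Type} [Fintype ι] {σ : Finset ι} {Z : Set (ι → ℝ)}

theorem DefPred.iUnion_wideFibres (hZ : DefPred L (· ∈ Z)) :
    DefPred L (· ∈ ⋃ j, Paper.wideFibres σ Z j) :=
  (DefPred.exists_finite fun j => DefPred.wideFibres hZ j).congr fun _ => mem_iUnion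

theorem exists_rat_box {z : ι → ℝ} {s : Set (ι → ℝ)} (hs : s ∈ 𝓝 z) :
    ∃ a b : ι → ℚ, (∀ i, (a i : ℝ) < z i ∧ z i < b i) ∧
      ∀ w : ι → ℝ, (∀ i, (a i : ℝ) < w i ∧ w i < b i) → w ∈ s := by
  obtain ⟨ε, hε, hsub⟩ := Metric.mem_nhds_iff.1 hs
  choose a ha1 ha2 using fun i => exists_rat_btwn (show z i - ε < z i by linarith)
  choose b hb1 hb2 using fun i => exists_rat_btwn (show z i < z i + ε by linarith)
  refine ⟨a, b, fun i => ⟨ha2 i, hb1 i⟩, fun w hw => hsub ?_⟩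
  refine Metric.mem_ball.2 ((dist_pi_lt_iff hε).2 fun i => ?_)
  rw [Real.dist_eq, abs_lt]
  constructor <;> linarith [ha1 i, hb2 i, (hw i).1, (hw i).2]

theorem eventually_fibreDist_eq {s : (σ → ℝ) → ι → ℝ} {z₀ : ι → ℝ} {B : Set (ι → ℝ)}
    (hB : B ∈ 𝓝 z₀) (hs : ContinuousAt s (pr σ z₀)) (hs₀ : s (pr σ z₀) = z₀)
    (h : ∀ᶠ x in 𝓝 (pr σ z₀), s x ∈ Z ∧ pr σ (s x) = x ∧
      ∀ z ∈ Z, pr σ z = x → z ∈ B → z = s x) :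
    ∀ᶠ z in 𝓝 z₀, fibreDist σ Z z = sqDist z (s (pr σ z)) := by
  obtain ⟨ε, hε, hsub⟩ := Metric.mem_nhds_iff.1 hB
  have hpr : ContinuousAt (pr σ) z₀ := (continuous_pr σ).continuousAt
  have h1 : ∀ᶠ z in 𝓝 z₀, sqDist z (s (pr σ z)) < (2 * ε / 3) ^ 2 := by
    have hc : ContinuousAt (fun z => sqDist z (s (pr σ z))) z₀ :=
      ContinuousAt.comp (g := fun p : (ι → ℝ) × (ι → ℝ) => sqDist p.1 p.2)
        (f := fun z => (z, s (pr σ z))) (contDiff_sqDist 0).continuous.continuousAt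
        (continuousAt_id.prodMk (ContinuousAt.comp (f := pr σ) hs hpr))
    refine hc.eventually_lt continuousAt_const ?_
    rw [hs₀, sqDist_self]
    positivity
  filter_upwards [h1, hpr.eventually h, Metric.ball_mem_nhds z₀ (show 0 < ε / 3 by positivity)]
    with z hz1 hz2 hz3
  obtain ⟨hz2, hz4, hz5⟩ := hz2
  refine le_antisymm (fibreDist_le hz2 hz4) ?_
  by_contra! hlt
  obtain ⟨w, hw, hwz, hlt'⟩ := exists_of_fibreDist_lt ⟨_, hz2, hz4⟩ hlt
  by_cases hwB : w ∈ B
  · rw [hz5 w hw hwz hwB] at hlt'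
    exact lt_irrefl _ hlt'
  · have h2 : ε ≤ dist w z₀ := by
      by_contra! hc
      exact hwB (hsub hc)
    have h3 : dist z z₀ < ε / 3 := hz3
    have h4 := dist_sq_le_sqDist z w
    have h5 := dist_triangle w z z₀
    rw [dist_comm w z] at h5
    nlinarith

theorem DefPred.interior_image_not_contDiffAt (hZ : DefPred L (· ∈ Z))
    (hσ : ∀ τ ∈ fullProjections Z, ¬ σ ⊂ τ) (r : ℕ) :
    _root_.interior (Paper.pr σ '' {z | z ∈ Z ∧ ¬ ContDiffAt ℝ r (Paper.fibreDist σ Z) z}) = ∅ := by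
  by_contra hne
  have hInf := DefPred.iUnion_wideFibres (σ := σ) hZ
  have hInf' := DefPred.interior_closure_eq_empty hInf (DefPred.iUnion_interior_eq_empty
    (DefPred.wideFibres hZ) (DefPred.interior_wideFibres hZ hσ))
  set X := Paper.pr σ '' {z | z ∈ Z ∧ ¬ ContDiffAt ℝ r (Paper.fibreDist σ Z) z} with hX
  have hO : (_root_.interior X \ _root_.closure (⋃ j, Paper.wideFibres σ Z j)).Nonempty := by
    rw [sdiff_nonempty]
    intro hsub
    have := interior_maximal hsub isOpen_interior
    rw [hInf'] at this
    exact hne (subset_empty_iff.1 this)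
  have hbox : ∀ k : (ι → ℚ) × (ι → ℚ),
      DefPred L fun z : ι → ℝ => ∀ i, (k.1 i : ℝ) < z i ∧ z i < k.2 i := fun k =>
    DefPred.forall_finite fun i => DefPred.and DefPred.lt DefPred.lt
  have hCD : DefPred L fun z : ι → ℝ => ContDiffAt ℝ r (Paper.fibreDist σ Z) z :=
    DefPred.contDiffAt (DefFun.fibreDist hZ) r
  obtain ⟨k, x₁, -, hx₁⟩ := exists_inter_interior_nonempty (L := L) (κ := (ι → ℚ) × (ι → ℚ))
    (S := fun k => {x | ∃ z, ((z ∈ Z ∧ ¬ ContDiffAt ℝ r (Paper.fibreDist σ Z) z) ∧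
      Paper.pr σ z = x ∧ ∀ i, (k.1 i : ℝ) < z i ∧ z i < k.2 i) ∧
      ∀ z', z' ∈ Z → Paper.pr σ z' = x → (∀ i, (k.1 i : ℝ) < z' i ∧ z' i < k.2 i) → z' = z})
    (fun k => DefPred.ex (DefPred.and
      (DefPred.and (DefPred.and hZ hCD.not).comp_snd (DefPred.and
        (DefPred.eq (by fun_prop) (by fun_prop)) (hbox k).comp_snd))
      (DefPred.all (DefPred.imp hZ.comp_snd (DefPred.imp (DefPred.eq (by fun_prop) (by fun_prop))
        (DefPred.imp (hbox k).comp_snd (DefPred.eq (by fun_prop) (by fun_prop))))))))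
    (isOpen_interior.sdiff isClosed_closure) hO (by
      rintro x ⟨hx, hx'⟩
      obtain ⟨z, hz, hzx⟩ := interior_subset hx
      have hfin := DefPred.finite_fibre hZ fun h => hx' (subset_closure h)
      obtain ⟨a, b, hab, hab'⟩ := exists_rat_box (z := z)
        (s := ({w | w ∈ Z ∧ Paper.pr σ w = x} \ {z})ᶜ)
        ((hfin.subset sdiff_subset).isClosed.isOpen_compl.mem_nhds (by simp))
      refine mem_iUnion.2 ⟨(a, b), z, ⟨hz, hzx, hab⟩, fun w hw hwx hwab => ?_⟩
      by_contra hwz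
      exact hab' w hwab ⟨⟨hw, hwx⟩, hwz⟩)
  set S := {x | ∃ z, ((z ∈ Z ∧ ¬ ContDiffAt ℝ r (Paper.fibreDist σ Z) z) ∧
      Paper.pr σ z = x ∧ ∀ i, (k.1 i : ℝ) < z i ∧ z i < k.2 i) ∧
      ∀ z', z' ∈ Z → Paper.pr σ z' = x → (∀ i, (k.1 i : ℝ) < z' i ∧ z' i < k.2 i) → z' = z}
    with hS
  let s : (σ → ℝ) → ι → ℝ := fun x i => sInf {t | ∃ z, (z ∈ Z ∧ Paper.pr σ z = x ∧
    ∀ i, (k.1 i : ℝ) < z i ∧ z i < k.2 i) ∧ z i = t}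
  have hsdef : ∀ i, DefFun L fun x => s x i := fun i =>
    DefFun.csInf (DefPred.ex (DefPred.and (DefPred.and hZ.comp_snd (DefPred.and
      (DefPred.eq (by fun_prop) (by fun_prop)) (hbox k).comp_snd))
      (DefPred.eq (by fun_prop) (by fun_prop))))
  have hs : ∀ x z, z ∈ Z → Paper.pr σ z = x → (∀ i, (k.1 i : ℝ) < z i ∧ z i < k.2 i) →
      (∀ z', z' ∈ Z → Paper.pr σ z' = x → (∀ i, (k.1 i : ℝ) < z' i ∧ z' i < k.2 i) → z' = z) →
      s x = z := by
    intro x z hz hzx hzk huniq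
    funext i
    have : {t | ∃ z, (z ∈ Z ∧ Paper.pr σ z = x ∧
        ∀ i, (k.1 i : ℝ) < z i ∧ z i < k.2 i) ∧ z i = t} = {z i} := by
      ext t
      constructor
      · rintro ⟨w, ⟨hw, hwx, hwk⟩, rfl⟩
        rw [huniq w hw hwx hwk]
        rfl
      · rintro rfl
        exact ⟨z, ⟨hz, hzx, hzk⟩, rfl⟩
    simp only [s, this, csInf_singleton]
  have hbad := DefPred.iUnion_interior_eq_empty (L := L)
    (S := fun i => {x | ¬ ContDiffAt ℝ r (fun x => s x i) x})
    (fun i => (DefPred.contDiffAt (hsdef i) r).not)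
    (fun i => DefFun.interior_not_contDiffAt (hsdef i) r)
  obtain ⟨x₀, hx₀, hx₀'⟩ : ∃ x ∈ _root_.interior S, ∀ i, ContDiffAt ℝ r (fun x => s x i) x := by
    by_contra! hall
    have : _root_.interior S ⊆ ⋃ i, {x | ¬ ContDiffAt ℝ r (fun x => s x i) x} :=
      fun x hx => mem_iUnion.2 (hall x hx)
    have := interior_maximal this isOpen_interior
    rw [hbad] at this
    exact this hx₁
  have hscd : ContDiffAt ℝ r s x₀ := contDiffAt_pi.2 hx₀'
  obtain ⟨z₀, ⟨⟨hz₀, hz₀'⟩, rfl, hz₀k⟩, huniq⟩ := interior_subset hx₀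
  have hs₀ := hs _ z₀ hz₀ rfl hz₀k huniq
  refine hz₀' ?_
  have hev := eventually_fibreDist_eq (Z := Z) (B := {z | ∀ i, (k.1 i : ℝ) < z i ∧ z i < k.2 i})
    (z₀ := z₀) (Filter.eventually_all.2 fun i =>
      (isOpen_Ioo.preimage (continuous_apply i)).mem_nhds (hz₀k i)) hscd.continuousAt hs₀ (by
        filter_upwards [isOpen_interior.mem_nhds hx₀] with x hx
        obtain ⟨z, ⟨⟨hz, -⟩, hzx, hzk⟩, hu⟩ := interior_subset hx
        rw [hs x z hz hzx hzk hu]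
        exact ⟨hz, hzx, fun w hw hwx hwk => hu w hw hwx hwk⟩)
  refine ContDiffAt.congr_of_eventuallyEq ?_ hev
  exact ContDiffAt.comp (g := fun p : (ι → ℝ) × (ι → ℝ) => Paper.sqDist p.1 p.2)
    (f := fun z => (z, s (Paper.pr σ z))) z₀ (contDiff_sqDist r).contDiffAt
    (contDiffAt_id.prodMk (hscd.comp z₀ (contDiff_pr σ r).contDiffAt))

end

section
variable {L : FirstOrder.Language} [L.Structure ℝ]
variable {ι : Type} [Fintype ι] {σ : Finset ι} {Z : Set (ι → ℝ)}

theorem eventually_radius {G : Set (ι → ℝ)} {α : (ι → ℝ) → ℝ} {z : ι → ℝ} (hG : G ∈ 𝓝 z)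
    (hα : ∃ C, ∀ᶠ w in 𝓝 z, α w ≤ C) :
    ∀ᶠ ρ in 𝓝[>] (0 : ℝ), ∀ w, sqDist w z < ρ → w ∈ G ∧ α w ≤ ρ⁻¹ := by
  obtain ⟨C, hC⟩ := hα
  obtain ⟨ε, hε, hsub⟩ := Metric.mem_nhds_iff.1 (Filter.inter_mem hG hC)
  filter_upwards [tendsto_inv_nhdsGT_zero.eventually_ge_atTop C,
    mem_nhdsWithin_of_mem_nhds (Iio_mem_nhds (show 0 < ε ^ 2 by positivity))] with ρ h1 h2 w hw
  have h3 : dist w z < ε := by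
    have := dist_sq_le_sqDist w z
    have h4 : ρ < ε ^ 2 := h2
    exact lt_of_pow_lt_pow_left₀ 2 hε.le (by linarith)
  exact ⟨(hsub h3).1, le_trans (hsub h3).2 h1⟩

variable [LocallyOMinimalField L]

/-- Over a dense open part of its projection, `Z` has a tubular neighbourhood whose radius is a
`C^r` function of the projection and on which `α` is controlled. -/
theorem exists_tube {W : Set (ι → ℝ)} {α : (ι → ℝ) → ℝ} (r : ℕ) (hZ : DefPred L (· ∈ Z))
    (hσ : ∀ τ ∈ fullProjections Z, ¬ σ ⊂ τ) (hW : IsOpen W) (hWdef : DefPred L (· ∈ W))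
    (hZW : Z ⊆ W) (hα : DefFun L α) (hbdd : ∀ z ∈ Z, ∃ C, ∀ᶠ w in 𝓝 z, α w ≤ C) :
    ∃ (V : Set (σ → ℝ)) (κ : (σ → ℝ) → ℝ), IsOpen V ∧ DefPred L (· ∈ V) ∧ DefFun L κ ∧
      interior (pr σ '' Z \ V) = ∅ ∧ ∀ x ∈ V, x ∈ pr σ '' Z ∧ 0 < κ x ∧ ContDiffAt ℝ r κ x ∧
        ∀ z ∈ Z, pr σ z = x → ∀ w, sqDist w z * κ x < 1 →
          (ContDiffAt ℝ r (fibreDist σ Z) w ∧ w ∈ W) ∧ α w ≤ κ x := by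
  have hCD : DefPred L fun z : ι → ℝ => ContDiffAt ℝ r (fibreDist σ Z) z :=
    DefPred.contDiffAt (DefFun.fibreDist hZ) r
  have hInf := DefPred.iUnion_wideFibres (σ := σ) hZ
  have hInf' := DefPred.iUnion_interior_eq_empty
    (DefPred.wideFibres hZ) (DefPred.interior_wideFibres hZ hσ)
  set B := (⋃ j, wideFibres σ Z j) ∪ pr σ '' {z | z ∈ Z ∧ ¬ ContDiffAt ℝ r (fibreDist σ Z) z}
    with hB
  have hBdef : DefPred L (· ∈ B) := DefPred.or hInf (DefPred.image
    (Z := {z | z ∈ Z ∧ ¬ ContDiffAt ℝ r (fibreDist σ Z) z}) (DefPred.and hZ hCD.not)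
    (by fun_prop))
  have hBint : interior (closure B) = ∅ := DefPred.interior_closure_eq_empty hBdef
    (DefPred.interior_union_eq_empty hInf hInf' (DefPred.interior_image_not_contDiffAt hZ hσ r))
  have himg : DefPred L (· ∈ pr σ '' Z) := DefPred.image hZ (by fun_prop)
  let P : (σ → ℝ) → ℝ → Prop := fun x ρ => ∀ z, z ∈ Z → pr σ z = x → ∀ w, sqDist w z < ρ →
    (ContDiffAt ℝ r (fibreDist σ Z) w ∧ w ∈ W) ∧ α w ≤ ρ⁻¹
  let ρ : (σ → ℝ) → ℝ := fun x => sSup {t | (0 < t ∧ t ≤ 1) ∧ P x t}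
  have hρ : DefFun L ρ := DefFun.csSup (DefPred.and (DefPred.and DefPred.lt DefPred.le)
    (DefPred.all (DefPred.imp hZ.comp_snd (DefPred.imp (DefPred.eq (by fun_prop) (by fun_prop))
      (DefPred.all (DefPred.imp DefPred.lt (DefPred.and (DefPred.and hCD hWdef).comp_snd
        DefPred.le)))))))
  let κ : (σ → ℝ) → ℝ := fun x => 2 / ρ x
  have hκ : DefFun L κ := by fun_prop
  have hκdef := (DefPred.contDiffAt hκ r)
  refine ⟨(interior (pr σ '' Z) \ closure B) ∩ {x | ContDiffAt ℝ r κ x}, κ,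
    (isOpen_interior.sdiff isClosed_closure).inter (isOpen_setOf_contDiffAt κ r),
    DefPred.and (DefPred.and (DefPred.interior himg) (DefPred.closure hBdef).not) hκdef, hκ,
    ?_, ?_⟩
  · refine subset_empty_iff.1 ((interior_mono (t := (pr σ '' Z \ interior (pr σ '' Z)) ∪
      (closure B ∪ {x | ¬ ContDiffAt ℝ r κ x})) ?_).trans (subset_empty_iff.2 ?_))
    · rintro x ⟨hx, hx'⟩
      by_cases h1 : x ∈ interior (pr σ '' Z)
      · by_cases h2 : x ∈ closure B
        · exact Or.inr (Or.inl h2)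
        · exact Or.inr (Or.inr fun h => hx' ⟨⟨h1, h2⟩, h⟩)
      · exact Or.inl ⟨hx, h1⟩
    · exact DefPred.interior_union_eq_empty
        (X := pr σ '' Z \ interior (pr σ '' Z)) (DefPred.and himg (DefPred.interior himg).not)
        (interior_diff_interior_self _)
        (DefPred.interior_union_eq_empty (DefPred.closure hBdef) hBint
          (DefFun.interior_not_contDiffAt hκ r))
  · rintro x ⟨⟨hx, hxB⟩, hxκ⟩
    have hfin := DefPred.finite_fibre hZ (x := x) fun h => hxB (subset_closure (Or.inl h))
    have hgood : ∀ z ∈ {z | z ∈ Z ∧ pr σ z = x}, ∀ᶠ t in 𝓝[>] (0 : ℝ), ∀ w, sqDist w z < t →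
        w ∈ {w | ContDiffAt ℝ r (fibreDist σ Z) w ∧ w ∈ W} ∧ α w ≤ t⁻¹ := by
      rintro z ⟨hz, hzx⟩
      refine eventually_radius (((isOpen_setOf_contDiffAt (fibreDist σ Z) r).inter hW).mem_nhds
        ⟨?_, hZW hz⟩) (hbdd z hz)
      by_contra hc
      exact hxB (subset_closure (Or.inr ⟨z, ⟨hz, hc⟩, hzx⟩))
    have hev := (Filter.eventually_all_finite hfin).2 hgood
    obtain ⟨t₀, h1, h3, h2⟩ := (hev.and (Ioo_mem_nhdsGT (show (0 : ℝ) < 1 by norm_num))).exists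
    have hbd : BddAbove {t | (0 < t ∧ t ≤ 1) ∧ P x t} := ⟨1, fun t ht => ht.1.2⟩
    have hmem : t₀ ∈ {t | (0 < t ∧ t ≤ 1) ∧ P x t} :=
      ⟨⟨h3, le_of_lt h2⟩, fun z hz hzx => h1 z ⟨hz, hzx⟩⟩
    have hpos : 0 < ρ x := lt_of_lt_of_le h3 (le_csSup hbd hmem)
    refine ⟨interior_subset hx, by positivity, hxκ, fun z hz hzx w hw => ?_⟩
    obtain ⟨t, ht, hlt⟩ := exists_lt_of_lt_csSup ⟨t₀, hmem⟩ (show ρ x / 2 < ρ x by linarith)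
    have hw' : sqDist w z < ρ x / 2 := by
      simp only [κ] at hw
      rw [← mul_div_assoc, div_lt_one hpos] at hw
      linarith
    obtain ⟨h4, h5⟩ := ht.2 z hz hzx w (hw'.trans hlt)
    refine ⟨h4, h5.trans ?_⟩
    simp only [κ]
    rw [inv_eq_one_div, div_le_div_iff₀ ht.1.1 hpos]
    linarith

end

section

theorem hasDerivAt_max_pow (n : ℕ) (t : ℝ) :
    HasDerivAt (fun t : ℝ => max 0 t ^ (n + 2)) ((n + 2 : ℕ) * max 0 t ^ (n + 1)) t := by
  rcases lt_trichotomy t 0 with h | rfl | h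
  · have : (fun t : ℝ => max 0 t ^ (n + 2)) =ᶠ[𝓝 t] fun _ => 0 := by
      filter_upwards [Iio_mem_nhds h] with s hs
      rw [max_eq_left (le_of_lt hs), zero_pow (by omega)]
    rw [max_eq_left h.le, zero_pow (by omega), mul_zero]
    exact (hasDerivAt_const t 0).congr_of_eventuallyEq this
  · have h1 : HasDerivWithinAt (fun t : ℝ => max 0 t ^ (n + 2)) 0 (Iic 0) 0 :=
      (hasDerivWithinAt_const (0 : ℝ) (Iic 0) (0 : ℝ)).congr
        (fun s hs => by rw [max_eq_left hs, zero_pow (by omega)]) (by simp)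
    have h2 : HasDerivWithinAt (fun t : ℝ => max 0 t ^ (n + 2)) 0 (Ici 0) 0 := by
      have := (hasDerivAt_pow (n + 2) (0 : ℝ)).hasDerivWithinAt (s := Ici 0)
      simp only [Nat.add_succ_sub_one, ne_eq, Nat.add_eq_zero_iff, one_ne_zero, and_false,
        not_false_eq_true, zero_pow, mul_zero] at this
      exact this.congr (fun s hs => by rw [max_eq_right hs]) (by simp)
    simpa [← hasDerivWithinAt_univ, Iic_union_Ici] using h1.union h2
  · have : (fun t : ℝ => max 0 t ^ (n + 2)) =ᶠ[𝓝 t] fun t => t ^ (n + 2) := by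
      filter_upwards [Ioi_mem_nhds h] with s hs
      rw [max_eq_right (le_of_lt hs)]
    rw [max_eq_right h.le]
    exact (hasDerivAt_pow (n + 2) t).congr_of_eventuallyEq this

theorem contDiff_max_pow (r : ℕ) : ContDiff ℝ r fun t : ℝ => max 0 t ^ (r + 1) := by
  induction r with
  | zero =>
    rw [Nat.cast_zero, contDiff_zero]
    fun_prop
  | succ r ih =>
    rw [Nat.cast_add, Nat.cast_one, contDiff_succ_iff_deriv]
    refine ⟨fun t => (hasDerivAt_max_pow r t).differentiableAt, by simp, ?_⟩
    rw [funext fun t => (hasDerivAt_max_pow r t).deriv]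
    exact contDiff_const.mul ih

variable {L : FirstOrder.Language} [L.Structure ℝ] [LocallyOMinimalField L]
variable {ι : Type} [Fintype ι] {σ : Finset ι} {Z : Set (ι → ℝ)}

/-- A nonnegative `C^r` function supported in `W` which dominates `α` near the part of `Z` lying
over a dense open subset of a maximal full projection. -/
theorem exists_bump {W : Set (ι → ℝ)} {α : (ι → ℝ) → ℝ} (r : ℕ) (hZ : DefPred L (· ∈ Z))
    (hσ : ∀ τ ∈ fullProjections Z, ¬ σ ⊂ τ) (hW : IsOpen W) (hWdef : DefPred L (· ∈ W))
    (hZW : Z ⊆ W) (hα : DefFun L α) (hbdd : ∀ z ∈ Z, ∃ C, ∀ᶠ w in 𝓝 z, α w ≤ C)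
    (hext : ∀ V : Set (σ → ℝ), IsOpen V → DefPred L (· ∈ V) → ∃ g : (σ → ℝ) → ℝ, DefFun L g ∧
      ∀ x ∈ V, ContDiffAt ℝ r g x ∧ (Metric.infDist x Vᶜ)⁻¹ ≤ g x) :
    ∃ (V : Set (σ → ℝ)) (b : (ι → ℝ) → ℝ), IsOpen V ∧ DefPred L (· ∈ V) ∧ DefFun L b ∧
      interior (pr σ '' Z \ V) = ∅ ∧ (∀ z, 0 ≤ b z) ∧
      (∀ z, pr σ z ∈ V ∨ z ∉ closure Z → ContDiffAt ℝ r b z) ∧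
      (∀ z, z ∉ W → b z = 0) ∧ ∀ z ∈ Z, pr σ z ∈ V → ∀ᶠ w in 𝓝 z, α w ≤ b w := by
  classical
  obtain ⟨V, κ, hV, hVdef, hκ, hVint, H⟩ := exists_tube r hZ hσ hW hWdef hZW hα hbdd
  obtain ⟨g, hg, hgV⟩ := hext V hV hVdef
  let c : (σ → ℝ) → ℝ := fun x => g x ^ 2 + κ x
  let D := fibreDist σ Z
  let b : (ι → ℝ) → ℝ := fun z =>
    if pr σ z ∈ V then κ (pr σ z) * max 0 (2 - 8 * (D z * c (pr σ z))) ^ (r + 1) else 0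
  have hD : DefFun L D := DefFun.fibreDist hZ
  have hb : DefFun L b := by
    have hP : DefPred L fun z : ι → ℝ => pr σ z ∈ V := hVdef.comp (f := pr σ) (by fun_prop)
    have hκ' : DefFun L fun z : ι → ℝ => κ (pr σ z) := hκ.comp (f := pr σ) (by fun_prop)
    have hg' : DefFun L fun z : ι → ℝ => g (pr σ z) := hg.comp (f := pr σ) (by fun_prop)
    exact DefPred.ite hP (by fun_prop) (by fun_prop)
  have hκpos : ∀ x ∈ V, 0 < κ x := fun x hx => (H x hx).2.1
  have hDnn : ∀ z, 0 ≤ D z := fibreDist_nonneg σ Z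
  have hclose : ∀ z, pr σ z ∈ V → ∀ ε, D z * κ (pr σ z) < ε →
      ∃ w ∈ Z, pr σ w = pr σ z ∧ sqDist z w * κ (pr σ z) < ε := by
    intro z hz ε hlt
    obtain ⟨w, hw, hwz, h⟩ := exists_of_fibreDist_lt (H _ hz).1
      ((lt_div_iff₀ (hκpos _ hz)).2 hlt)
    exact ⟨w, hw, hwz, (lt_div_iff₀ (hκpos _ hz)).1 h⟩
  have hsupp : ∀ z, b z ≠ 0 → pr σ z ∈ V ∧ D z * c (pr σ z) < 1 / 4 := by
    intro z hz
    by_cases h : pr σ z ∈ V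
    · refine ⟨h, ?_⟩
      by_contra! hc
      refine hz ?_
      simp only [b, if_pos h]
      rw [max_eq_left (by linarith), zero_pow (by omega), mul_zero]
    · exact absurd (if_neg h) hz
  have hDκ : ∀ z ε, D z * c (pr σ z) < ε → D z * κ (pr σ z) < ε := fun z ε h =>
    lt_of_le_of_lt (mul_le_mul_of_nonneg_left
      (le_add_of_nonneg_left (sq_nonneg (g (pr σ z)))) (hDnn z)) h
  have hcd : ∀ z, pr σ z ∈ V → ContDiffAt ℝ r D z →
      ContDiffAt ℝ r (fun z => D z * c (pr σ z)) z := fun z hz hDz => by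
    have h1 : ContDiffAt ℝ r c (pr σ z) := ((hgV _ hz).1.pow 2).add (H _ hz).2.2.1
    exact hDz.mul (h1.comp z (contDiff_pr σ r).contDiffAt)
  have hnear : ∀ z, pr σ z ∈ V → ∀ᶠ w in 𝓝 z, pr σ w ∈ V := fun z hz =>
    (continuous_pr σ).continuousAt.eventually (hV.mem_nhds hz)
  refine ⟨V, b, hV, hVdef, hb, hVint, fun z => ?_, fun z hz => ?_, fun z hz => ?_, fun z hz hzV => ?_⟩
  · by_cases h : pr σ z ∈ V
    · simp only [b, if_pos h]
      have := hκpos _ h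
      positivity
    · simp only [b, if_neg h, le_refl]
  · by_cases hzV : pr σ z ∈ V
    · have hκz : ContDiffAt ℝ r (fun z => κ (pr σ z)) z :=
        (H _ hzV).2.2.1.comp z (contDiff_pr σ r).contDiffAt
      by_cases hDz : ContDiffAt ℝ r D z
      · have h1 : b =ᶠ[𝓝 z] fun z =>
            κ (pr σ z) * max 0 (2 - 8 * (D z * c (pr σ z))) ^ (r + 1) := by
          filter_upwards [hnear z hzV] with w hw
          simp only [b, if_pos hw]
        refine ContDiffAt.congr_of_eventuallyEq ?_ h1
        exact hκz.mul ((contDiff_max_pow r).contDiffAt.comp z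
          (contDiffAt_const.sub (contDiffAt_const.mul (hcd z hzV hDz))))
      · have h2 : ∀ᶠ w in 𝓝 z, sqDist z w * κ (pr σ w) < 1 / 4 := by
          have hc : ContinuousAt (fun w => sqDist z w * κ (pr σ w)) z :=
            (ContinuousAt.comp (g := fun p : (ι → ℝ) × (ι → ℝ) => sqDist p.1 p.2)
              (f := fun w => (z, w)) (contDiff_sqDist 0).continuous.continuousAt
              (continuousAt_const.prodMk continuousAt_id)).mul hκz.continuousAt
          refine hc.eventually_lt continuousAt_const ?_
          rw [sqDist_self]
          norm_num
        have h1 : b =ᶠ[𝓝 z] fun _ => 0 := by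
          filter_upwards [h2] with w hw
          by_contra hbw
          obtain ⟨hwV, hDw⟩ := hsupp w hbw
          obtain ⟨u, hu, huw, hlt⟩ := hclose w hwV _ (hDκ w _ hDw)
          refine hDz ((H _ hwV).2.2.2 u hu huw z ?_).1.1
          have := mul_le_mul_of_nonneg_right (sqDist_le z w u) (hκpos _ hwV).le
          linarith
        exact contDiffAt_const.congr_of_eventuallyEq h1
    · replace hz := hz.resolve_left hzV
      obtain ⟨ε, hε, hball⟩ := Metric.mem_nhds_iff.1 (isClosed_closure.isOpen_compl.mem_nhds hz)
      have h1 : b =ᶠ[𝓝 z] fun _ => 0 := by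
        filter_upwards [Metric.ball_mem_nhds z (show 0 < ε / 2 by positivity)] with w hw
        by_contra hbw
        obtain ⟨hwV, hDw⟩ := hsupp w hbw
        have h2 : 0 < Metric.infDist (pr σ w) Vᶜ :=
          (hV.isClosed_compl.notMem_iff_infDist_pos ⟨_, hzV⟩).1 fun h => h hwV
        have h3 : Metric.infDist (pr σ w) Vᶜ < ε / 2 :=
          lt_of_le_of_lt ((Metric.infDist_le_dist_of_mem hzV).trans (dist_pr_le σ w z)) hw
        have h4 : (ε / 2)⁻¹ ≤ g (pr σ w) :=
          ((inv_le_inv₀ (by positivity) h2).2 h3.le).trans (hgV _ hwV).2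
        have h5 : (ε / 2)⁻¹ ^ 2 ≤ c (pr σ w) :=
          (pow_le_pow_left₀ (by positivity) h4 2).trans (le_add_of_nonneg_right (hκpos _ hwV).le)
        have h6 : D w * (ε / 2)⁻¹ ^ 2 < 1 / 4 :=
          lt_of_le_of_lt (mul_le_mul_of_nonneg_left h5 (hDnn w)) hDw
        rw [inv_pow, ← div_eq_mul_inv, div_lt_iff₀ (by positivity)] at h6
        obtain ⟨u, hu, -, hlt⟩ := exists_of_fibreDist_lt (H _ hwV).1 h6
        have h7 : dist w u < ε / 2 := by
          refine lt_of_pow_lt_pow_left₀ 2 (by positivity) ?_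
          nlinarith [dist_sq_le_sqDist w u]
        refine hball (Metric.mem_ball.2 ?_) (subset_closure hu)
        have h8 : dist w z < ε / 2 := hw
        have := dist_triangle u w z
        rw [dist_comm u w] at this
        linarith
      exact contDiffAt_const.congr_of_eventuallyEq h1
  · by_contra hbz
    obtain ⟨hzV, hDz⟩ := hsupp z hbz
    obtain ⟨u, hu, huz, hlt⟩ := hclose z hzV _ (hDκ z _ hDz)
    exact hz ((H _ hzV).2.2.2 u hu huz z (by linarith)).1.2
  · have hD0 : D z = 0 := le_antisymm (by simpa [sqDist_self] using fibreDist_le hz rfl) (hDnn z)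
    have hDz : ContDiffAt ℝ r D z :=
      ((H _ hzV).2.2.2 z hz rfl z (by rw [sqDist_self]; norm_num)).1.1
    have h1 : ∀ᶠ w in 𝓝 z, D w * c (pr σ w) < 1 / 8 := by
      refine (hcd z hzV hDz).continuousAt.eventually_lt continuousAt_const ?_
      rw [hD0]
      norm_num
    filter_upwards [h1, hnear z hzV] with w hw hwV
    obtain ⟨u, hu, huw, hlt⟩ := hclose w hwV _ (hDκ w _ hw)
    have h2 := ((H _ hwV).2.2.2 u hu huw w (by linarith)).2
    refine h2.trans ?_
    simp only [b, if_pos hwV]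
    refine le_mul_of_one_le_right (hκpos _ hwV).le (one_le_pow₀ (le_max_of_le_right ?_))
    linarith

end

section
variable {L : FirstOrder.Language} [L.Structure ℝ]

theorem exists_eventually_inv_infDist_le {X : Type*} [PseudoMetricSpace X] {s : Set X}
    (hs : IsClosed s) {x : X} (hx : x ∉ s) : ∃ C, ∀ᶠ w in 𝓝 x, (Metric.infDist w s)⁻¹ ≤ C := by
  rcases s.eq_empty_or_nonempty with rfl | hne
  · exact ⟨0, by simp⟩
  · have hpos := (hs.notMem_iff_infDist_pos hne).1 hx
    have hc : ContinuousAt (fun w => (Metric.infDist w s)⁻¹) x :=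
      (Metric.continuous_infDist_pt s).continuousAt.inv₀ hpos.ne'
    exact ⟨_, (hc.eventually_lt continuousAt_const (lt_add_one _)).mono fun _ h => h.le⟩

variable {ι : Type} [Fintype ι] {U Z Z' : Set (ι → ℝ)}

/-- Near `Z`, definable functions locally bounded above on `U` are dominated by nonnegative
definable `C^r` functions on `U` supported in a given neighbourhood of `Z`. -/
def Controls (L : FirstOrder.Language) [L.Structure ℝ] (r : ℕ) (U Z : Set (ι → ℝ)) : Prop :=
  ∀ (W : Set (ι → ℝ)) (α : (ι → ℝ) → ℝ), IsOpen W → DefPred L (· ∈ W) → Z ⊆ W → DefFun L α →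
    (∀ x ∈ U, ∃ C, ∀ᶠ w in 𝓝 x, α w ≤ C) →
    ∃ β : (ι → ℝ) → ℝ, DefFun L β ∧ (∀ x ∈ U, ContDiffAt ℝ r β x) ∧ (∀ x, 0 ≤ β x) ∧
      (∀ x, x ∉ W → β x = 0) ∧ ∀ z ∈ Z, ∀ᶠ w in 𝓝 z, α w ≤ β w

/-- Definable functions locally bounded above on an open set are dominated there by definable
`C^r` functions. -/
def Dominates (L : FirstOrder.Language) [L.Structure ℝ] (r : ℕ) (ι : Type) [Fintype ι] : Prop :=
  ∀ (U : Set (ι → ℝ)) (α : (ι → ℝ) → ℝ), IsOpen U → DefPred L (· ∈ U) → DefFun L α →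
    (∀ x ∈ U, ∃ C, ∀ᶠ w in 𝓝 x, α w ≤ C) →
    ∃ β : (ι → ℝ) → ℝ, DefFun L β ∧ ∀ x ∈ U, ContDiffAt ℝ r β x ∧ α x ≤ β x

variable [LocallyOMinimalField L] {r : ℕ}

theorem DefFun.infDist {s : Set (ι → ℝ)} (hs : DefPred L (· ∈ s)) :
    DefFun L fun x => Metric.infDist x s := by
  have h : DefFun L fun x : ι → ℝ => sInf {t | ∃ y, y ∈ s ∧ dist x y = t} :=
    DefFun.csInf (DefPred.ex (DefPred.and hs.comp_snd (DefPred.eq (by fun_prop) (by fun_prop))))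
  convert h using 2 with x
  rw [Metric.infDist_eq_iInf, iInf]
  congr 1
  ext t
  simp

/-- A function of class `C^r` away from `Z` is modified near `Z` to be `C^r` on `U`. -/
theorem Controls.glue (hU : Controls L r U Z) {W : Set (ι → ℝ)} {α b : (ι → ℝ) → ℝ}
    (hW : IsOpen W) (hWdef : DefPred L (· ∈ W)) (hZW : Z ⊆ W) (hα : DefFun L α)
    (hbdd : ∀ x ∈ U, ∃ C, ∀ᶠ w in 𝓝 x, α w ≤ C) (hb : DefFun L b) (hb0 : ∀ z, 0 ≤ b z)
    (hbr : ∀ z ∈ U, z ∉ Z → ContDiffAt ℝ r b z) :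
    ∃ β : (ι → ℝ) → ℝ, DefFun L β ∧ (∀ x ∈ U, ContDiffAt ℝ r β x) ∧ (∀ x, 0 ≤ β x) ∧
      (∀ x, x ∉ W → b x = 0 → β x = 0) ∧ (∀ z ∈ Z, ∀ᶠ w in 𝓝 z, α w ≤ β w) ∧
      ∀ w, α w ≤ b w → α w ≤ β w := by
  obtain ⟨β', hβ', hβr', hβ0', hβW', hβZ'⟩ := hU W α hW hWdef hZW hα hbdd
  obtain ⟨β₁, hβ₁, hβr₁, hβ0₁, hβN₁, hβZ₁⟩ := hU (interior {w | α w ≤ β' w} ∩ W) (fun _ => 1)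
    (isOpen_interior.inter hW) (DefPred.and (DefPred.interior DefPred.le) hWdef)
    (fun z hz => ⟨mem_interior_iff_mem_nhds.2 (hβZ' z hz), hZW hz⟩) (DefFun.const 1)
    fun _ _ => ⟨1, by simp⟩
  have hnn : ∀ x, 0 ≤ max 0 (1 - β₁ x) ^ (r + 1) * b x := fun x =>
    mul_nonneg (by positivity) (hb0 x)
  have hZev : ∀ z ∈ Z, (fun x => β' x + max 0 (1 - β₁ x) ^ (r + 1) * b x) =ᶠ[𝓝 z] β' := by
    intro z hz
    filter_upwards [hβZ₁ z hz] with w hw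
    rw [max_eq_left (by linarith), zero_pow (by omega), zero_mul, add_zero]
  refine ⟨fun x => β' x + max 0 (1 - β₁ x) ^ (r + 1) * b x, by fun_prop, fun x hx => ?_,
    fun x => add_nonneg (hβ0' x) (hnn x), fun x hx hbx => by simp [hβW' x hx, hbx],
    fun z hz => ?_, fun w hw => ?_⟩
  · by_cases hxZ : x ∈ Z
    · exact (hβr' x hx).congr_of_eventuallyEq (hZev x hxZ)
    · exact (hβr' x hx).add (((contDiff_max_pow r).contDiffAt.comp x
        (contDiffAt_const.sub (hβr₁ x hx))).mul (hbr x hx hxZ))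
  · filter_upwards [hZev z hz, hβZ' z hz] with w hw hw'
    rwa [hw]
  · by_cases hN : w ∈ interior {w | α w ≤ β' w} ∩ W
    · have h1 : w ∈ {w | α w ≤ β' w} := interior_subset hN.1
      exact le_trans h1 (le_add_of_nonneg_right (hnn w))
    · beta_reduce
      rw [hβN₁ w hN]
      simp only [sub_zero, zero_le_one, sup_of_le_right, one_pow, one_mul]
      exact hw.trans (le_add_of_nonneg_left (hβ0' w))

theorem Dominates.exists_inv_infDist_le (h : Dominates L r ι) {V : Set (ι → ℝ)} (hV : IsOpen V)
    (hVdef : DefPred L (· ∈ V)) : ∃ g : (ι → ℝ) → ℝ, DefFun L g ∧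
      ∀ x ∈ V, ContDiffAt ℝ r g x ∧ (Metric.infDist x Vᶜ)⁻¹ ≤ g x :=
  h V _ hV hVdef (DefFun.infDist (s := Vᶜ) hVdef.not).inv fun _ hx =>
    exists_eventually_inv_infDist_le hV.isClosed_compl fun hx' => hx' hx

theorem controls_of_interior_eq_empty
    (IH : ∀ σ : Finset ι, Fintype.card σ < Fintype.card ι → Dominates L r σ)
    (hUo : IsOpen U) (hZdef : DefPred L (· ∈ Z)) (hZU : Z ⊆ U) (hUZ : IsOpen (U \ Z)) (hZ : interior Z = ∅) :
    Controls L r U Z := by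
  induction hS : fullProjections Z using Finset.strongInduction generalizing Z with
  | H S ih =>
    subst hS
    intro W α hW hWdef hZW hα hbdd
    rcases (fullProjections Z).eq_empty_or_nonempty with h | h
    · obtain rfl := eq_empty_of_fullProjections h
      exact ⟨fun _ => 0, DefFun.const 0, fun _ _ => contDiffAt_const, fun _ => le_rfl,
        fun _ _ => rfl, fun _ h => h.elim⟩
    obtain ⟨σ, hσ⟩ := (fullProjections Z).exists_maximal h
    have hcard := card_lt_of_mem_fullProjections hZ hσ.1
    obtain ⟨V, b, hV, hVdef, hb, hVint, hb0, hbr, hbW, hbZ⟩ := exists_bump r hZdef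
      (fun τ hτ hlt => hσ.not_gt hτ hlt) hW hWdef hZW hα (fun z hz => hbdd z (hZU hz))
      fun V hV hVdef => (IH σ hcard).exists_inv_infDist_le hV hVdef
    have hZ'Z : {z | z ∈ Z ∧ pr σ z ∉ V} ⊆ Z := fun z hz => hz.1
    have hσ' : σ ∉ fullProjections {z | z ∈ Z ∧ pr σ z ∉ V} := by
      rw [mem_fullProjections, not_nonempty_iff_eq_empty, ← subset_empty_iff, ← hVint]
      refine interior_mono ?_
      rintro _ ⟨z, ⟨hz, hzV⟩, rfl⟩
      exact ⟨mem_image_of_mem _ hz, hzV⟩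
    have hctl : Controls L r U {z | z ∈ Z ∧ pr σ z ∉ V} := by
      refine ih _ ((Finset.ssubset_iff_of_subset (fullProjections_mono hZ'Z)).2 ⟨σ, hσ.1, hσ'⟩)
        (DefPred.and hZdef (hVdef.comp (f := pr σ) (by fun_prop)).not) (hZ'Z.trans hZU) ?_
        (subset_empty_iff.1 (hZ ▸ interior_mono hZ'Z)) rfl
      convert hUZ.union (hUo.inter (hV.preimage (continuous_pr σ))) using 1
      ext z
      simp only [mem_sdiff, mem_union, mem_inter_iff, mem_ofPred_eq, mem_preimage]
      tauto
    obtain ⟨β, hβ, hβr, hβ0, hβW, hβZ', hβle⟩ := hctl.glue hW hWdef (hZ'Z.trans hZW) hα hbdd hb hb0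
      fun z hz hz' => hbr z (by
        by_cases hzZ : z ∈ Z
        · exact Or.inl (not_not.1 fun h => hz' ⟨hzZ, h⟩)
        · refine Or.inr fun hcl => ?_
          obtain ⟨w, hw, hwZ⟩ := mem_closure_iff.1 hcl _ hUZ ⟨hz, hzZ⟩
          exact hw.2 hwZ)
    refine ⟨β, hβ, hβr, hβ0, fun x hx => hβW x hx (hbW x hx), fun z hz => ?_⟩
    by_cases hzV : pr σ z ∈ V
    · exact (hbZ z hz hzV).mono hβle
    · exact hβZ' z ⟨hz, hzV⟩

theorem dominates (L : FirstOrder.Language) [L.Structure ℝ] [LocallyOMinimalField L] (r : ℕ)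
    (ι : Type) [Fintype ι] : Dominates L r ι := by
  induction hn : Fintype.card ι using Nat.strong_induction_on generalizing ι with
  | h n ih =>
    subst hn
    intro U α hU hUdef hα hbdd
    have hCD := DefPred.contDiffAt hα r
    have hZ : Controls L r U {x | x ∈ U ∧ ¬ ContDiffAt ℝ r α x} := by
      refine controls_of_interior_eq_empty (fun σ hσ => ih _ hσ σ rfl) hU
        (DefPred.and hUdef hCD.not) (fun x hx => hx.1) ?_ (subset_empty_iff.1 ?_)
      · convert hU.inter (isOpen_setOf_contDiffAt α r) using 1
        ext x
        simp only [mem_sdiff, mem_inter_iff, mem_ofPred_eq]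
        tauto
      · rw [← DefFun.interior_not_contDiffAt hα r]
        exact interior_mono fun x hx => hx.2
    obtain ⟨β, hβ, hβr, -, -, -, hle⟩ := hZ.glue (b := fun x => α x ^ 2 + 1) hU hUdef
      (fun x hx => hx.1) hα hbdd (by fun_prop) (fun z => by positivity) fun z hz hz' =>
        ((not_not.1 fun h => hz' ⟨hz, h⟩).pow 2).add contDiffAt_const
    exact ⟨β, hβ, fun x hx => ⟨hβr x hx, hle x (by nlinarith [sq_nonneg (α x - 1)])⟩⟩

end

section
variable {L : FirstOrder.Language} [L.Structure ℝ] {E : Type} [Coord E] {m n : ℕ}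

/-- The point of `ℝᵐ⁺¹` with first coordinates `x` and last coordinate `t`. -/
def snoc (x : Fin m → ℝ) (t : ℝ) : Fin (m + 1) → ℝ := Fin.snoc (α := fun _ => ℝ) x t

/-- The first `m` coordinates of a point of `ℝᵐ⁺¹`. -/
def init (y : Fin (m + 1) → ℝ) : Fin m → ℝ := fun i => y i.castSucc

@[simp]
theorem snoc_castSucc (x : Fin m → ℝ) (t : ℝ) (i : Fin m) : snoc x t i.castSucc = x i :=
  Fin.snoc_castSucc (α := fun _ => ℝ) t x i

@[simp]
theorem snoc_last (x : Fin m → ℝ) (t : ℝ) : snoc x t (Fin.last m) = t :=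
  Fin.snoc_last (α := fun _ => ℝ) t x

@[simp]
theorem init_snoc (x : Fin m → ℝ) (t : ℝ) : init (snoc x t) = x := funext fun i => by simp [init]

@[simp]
theorem snoc_init_last (y : Fin (m + 1) → ℝ) : snoc (init y) (y (Fin.last m)) = y := by
  ext i
  induction i using Fin.lastCases <;> simp [init]

@[fun_prop]
theorem contDiff_init {k : WithTop ℕ∞} : ContDiff ℝ k (init : (Fin (m + 1) → ℝ) → Fin m → ℝ) :=
  contDiff_pi.2 fun i => contDiff_apply ℝ ℝ i.castSucc

@[fun_prop]
theorem continuous_init : Continuous (init : (Fin (m + 1) → ℝ) → Fin m → ℝ) :=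
  contDiff_init (k := 0).continuous

theorem ContDiffOn.snoc {F : Type*} [NormedAddCommGroup F] [NormedSpace ℝ F] {k : WithTop ℕ∞}
    {s : Set F} {f : F → Fin m → ℝ} {g : F → ℝ} (hf : ContDiffOn ℝ k f s)
    (hg : ContDiffOn ℝ k g s) : ContDiffOn ℝ k (fun x => snoc (f x) (g x)) s := by
  refine contDiffOn_pi.2 fun i => ?_
  induction i using Fin.lastCases with
  | last => simpa using hg
  | cast i => simpa using contDiffOn_pi.1 hf i

@[fun_prop]
theorem DefFun.snoc {f : E → Fin m → ℝ} {g : E → ℝ} (hf : DefFun L f) (hg : DefFun L g) :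
    DefFun L fun x => snoc (f x) (g x) := by
  refine DefFun.pi fun i => ?_
  induction i using Fin.lastCases with
  | last => simpa using hg
  | cast i => simpa using (show DefFun L fun x => f x i by fun_prop)

@[fun_prop]
theorem DefFun.init {f : E → Fin (m + 1) → ℝ} (hf : DefFun L f) : DefFun L fun x => init (f x) :=
  DefFun.pi fun i => show DefFun L fun x => f x i.castSucc by fun_prop

theorem defMapOn_iff {X : Set (Fin m → ℝ)} {f : (Fin m → ℝ) → Fin n → ℝ} :
    DefMapOn L m n X f ↔
      DefPred L fun p : (Fin m → ℝ) × (Fin n → ℝ) => p.1 ∈ X ∧ p.2 = f p.1 := by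
  constructor
  · intro h
    have h1 : DefPred L fun z : Fin (m + n) → ℝ => fstFun z ∈ X ∧ sndFun z = f (fstFun z) := h
    have h2 : DefFun L fun p : (Fin m → ℝ) × (Fin n → ℝ) => Fin.append p.1 p.2 := by
      refine DefFun.pi fun i => ?_
      induction i using Fin.addCases with
      | left i => simpa using (show DefFun L fun p : (Fin m → ℝ) × (Fin n → ℝ) => p.1 i by fun_prop)
      | right i => simpa using (show DefFun L fun p : (Fin m → ℝ) × (Fin n → ℝ) => p.2 i by fun_prop)
    refine (h1.comp h2).congr fun p => ?_
    have h3 : fstFun (Fin.append p.1 p.2) = p.1 := funext fun i => Fin.append_left _ _ _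
    have h4 : sndFun (Fin.append p.1 p.2) = p.2 := funext fun i => Fin.append_right _ _ _
    rw [h3, h4]
  · intro h
    exact h.comp (f := fun z : Fin (m + n) → ℝ => (fstFun z, sndFun z))
      (DefFun.prodMk (DefFun.pi fun i => DefFun.apply _) (DefFun.pi fun i => DefFun.apply _))

theorem defMapOn_of_defFun {X : Set (Fin m → ℝ)} {f : (Fin m → ℝ) → Fin n → ℝ}
    (hX : DefPred L (· ∈ X)) (hf : DefFun L f) : DefMapOn L m n X f :=
  defMapOn_iff.2 (DefPred.and hX.comp_fst hf)

theorem image_inter_eq_of_bijOn {α β : Type*} {φ : α → β} {U M : Set α} {V : Set β} {P : β → Prop}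
    (h : BijOn φ U V) : φ '' (M ∩ U) = {y ∈ V | P y} ↔ ∀ x ∈ U, x ∈ M ↔ P (φ x) := by
  constructor
  · intro him x hx
    constructor
    · intro hxM
      exact (him ▸ mem_image_of_mem φ ⟨hxM, hx⟩ : φ x ∈ {y ∈ V | P y}).2
    · intro hP
      obtain ⟨y, ⟨hyM, hy⟩, hyx⟩ : φ x ∈ φ '' (M ∩ U) := him ▸ ⟨h.mapsTo hx, hP⟩
      exact h.injOn hy hx hyx ▸ hyM
  · intro hM
    ext y
    constructor
    · rintro ⟨x, ⟨hxM, hx⟩, rfl⟩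
      exact ⟨h.mapsTo hx, (hM x hx).1 hxM⟩
    · rintro ⟨hy, hP⟩
      obtain ⟨x, hx, rfl⟩ := h.surjOn hy
      exact ⟨x, ⟨(hM x hx).2 hP, hx⟩, rfl⟩

theorem IsDefCrSubmanifold.isClosed_closure_diff {r d : ℕ} {M : Set (Fin m → ℝ)}
    (hM : IsDefCrSubmanifold L r m d M) : IsClosed (closure M \ M) := by
  refine isClosed_of_closure_subset fun x hx => ?_
  refine ⟨closure_minimal sdiff_subset isClosed_closure hx, fun hxM => ?_⟩
  obtain ⟨U, V, φ, ψ, hxU, hU, -, -, -, -, -, -, hφ, -, hbij, -, -, him⟩ := hM.2 x hxM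
  obtain ⟨y, hyU, hyM, hyM'⟩ := mem_closure_iff.1 hx U hU hxU
  have hiff := (image_inter_eq_of_bijOn hbij).1 him
  refine hyM' ((hiff y hyU).2 fun i hi => ?_)
  have hc : ContinuousAt (fun z => φ z i) y :=
    (continuous_apply i).continuousAt.comp (hφ.continuousOn.continuousAt (hU.mem_nhds hyU))
  by_contra hne
  obtain ⟨z, hz, hzM⟩ := mem_closure_iff_nhds.1 hyM _
    (Filter.inter_mem (hc.eventually_ne hne) (hU.mem_nhds hyU))
  exact hz.1 ((hiff z hz.2).1 hzM i hi)

variable [LocallyOMinimalField L]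

/-- The graph of `β` over `M`. -/
def graphOver (M : Set (Fin m → ℝ)) (β : (Fin m → ℝ) → ℝ) : Set (Fin (m + 1) → ℝ) :=
  {y | init y ∈ M ∧ y (Fin.last m) = β (init y)}

theorem IsDefCrSubmanifold.graphOver {r d : ℕ} {M U : Set (Fin m → ℝ)} {β : (Fin m → ℝ) → ℝ}
    (hM : IsDefCrSubmanifold L r m d M) (hU : IsOpen U) (hUdef : DefPred L (· ∈ U)) (hMU : M ⊆ U)
    (hβ : DefFun L β) (hβr : ∀ x ∈ U, ContDiffAt ℝ r β x) :
    IsDefCrSubmanifold L r (m + 1) (min d m) (graphOver M β) := by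
  have hMdef : DefPred L (· ∈ M) := hM.1
  have hβU : ContDiffOn ℝ r β U := fun x hx => (hβr x hx).contDiffWithinAt
  have hgraph : DefPred L (· ∈ Paper.graphOver M β) :=
    DefPred.and (hMdef.comp (f := init) (by fun_prop))
      (DefPred.eq (f := fun y : Fin (m + 1) → ℝ => y (Fin.last m)) (by fun_prop)
        (hβ.comp (f := init) (by fun_prop)))
  refine ⟨hgraph, fun a ha => ?_⟩
  obtain ⟨A, B, φ, ψ, haA, hA, hAdef, hB0, hB, hBdef, hφdef, hψdef, hφ, hψ, hbij, hinv, hφa, him⟩ :=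
    hM.2 (init a) ha.1
  replace hAdef : DefPred L (· ∈ A) := hAdef
  replace hBdef : DefPred L (· ∈ B) := hBdef
  rw [defMapOn_iff] at hφdef hψdef
  have hmaps : MapsTo ψ B A := hinv.1.mapsTo hbij.surjOn
  have hiff := (image_inter_eq_of_bijOn hbij).1 him
  let φ' : (Fin (m + 1) → ℝ) → Fin (m + 1) → ℝ := fun y =>
    snoc (φ (init y)) (y (Fin.last m) - β (init y))
  let ψ' : (Fin (m + 1) → ℝ) → Fin (m + 1) → ℝ := fun y =>
    snoc (ψ (init y)) (y (Fin.last m) + β (ψ (init y)))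
  let A' : Set (Fin (m + 1) → ℝ) := init ⁻¹' (A ∩ U)
  let B' : Set (Fin (m + 1) → ℝ) := init ⁻¹' (B ∩ ψ ⁻¹' U)
  have hφ' : MapsTo φ' A' B' := fun y hy =>
    ⟨by simpa [φ'] using hbij.mapsTo hy.1, by simpa [φ', hinv.1 hy.1] using hy.2⟩
  have hψ' : MapsTo ψ' B' A' := fun y hy =>
    ⟨by simpa [ψ'] using hmaps hy.1, by simpa [ψ'] using hy.2⟩
  have hinv' : InvOn ψ' φ' A' B' :=
    ⟨fun y hy => by simp [φ', ψ', hinv.1 hy.1], fun y hy => by simp [φ', ψ', hinv.2 hy.1]⟩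
  have hbij' : BijOn φ' A' B' := hinv'.bijOn hφ' hψ'
  have hlast {s} : ContDiffOn ℝ r (fun y : Fin (m + 1) → ℝ => y (Fin.last m)) s :=
    (contDiff_apply ℝ ℝ (Fin.last m)).contDiffOn
  have hinit {s} : ContDiffOn ℝ r (init : (Fin (m + 1) → ℝ) → Fin m → ℝ) s :=
    contDiff_init.contDiffOn
  refine ⟨A', B', φ', ψ', ⟨haA, hMU ha.1⟩, (hA.inter hU).preimage continuous_init,
    (DefPred.and hAdef hUdef).comp (f := init) (by fun_prop), ⟨hB0, ?_⟩,
    (hψ.continuousOn.isOpen_inter_preimage hB hU).preimage continuous_init, ?_, ?_, ?_,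
    ContDiffOn.snoc (hφ.comp hinit fun y hy => hy.1)
      (hlast.sub (hβU.comp hinit fun y hy => hy.2)), ?_, hbij', hinv', ?_,
    (image_inter_eq_of_bijOn hbij').2 fun y hy => ?_⟩
  · have : ψ (init 0) = init a := by
      rw [show init (0 : Fin (m + 1) → ℝ) = 0 from rfl, ← hφa, hinv.1 haA]
    exact (this ▸ hMU ha.1 : ψ (init 0) ∈ U)
  · have h : DefPred L fun v : Fin (m + 1) → ℝ =>
        ∃ u, (init v ∈ B ∧ u = ψ (init v)) ∧ u ∈ U :=
      DefPred.ex (DefPred.and (hψdef.comp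
        (f := fun q : (Fin (m + 1) → ℝ) × (Fin m → ℝ) => (init q.1, q.2)) (by fun_prop))
        hUdef.comp_snd)
    exact DefPred.congr (Q := (· ∈ B')) h fun v => by simp [B']
  · have h : DefPred L fun p : (Fin (m + 1) → ℝ) × (Fin (m + 1) → ℝ) =>
        ∃ u, (init p.1 ∈ A ∧ u = φ (init p.1)) ∧ init p.1 ∈ U ∧
          p.2 = snoc u (p.1 (Fin.last m) - β (init p.1)) :=
      DefPred.ex (DefPred.and (hφdef.comp
        (f := fun q : ((Fin (m + 1) → ℝ) × (Fin (m + 1) → ℝ)) × (Fin m → ℝ) => (init q.1.1, q.2))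
        (by fun_prop)) (DefPred.and (hUdef.comp (by fun_prop)) (DefPred.eq (by fun_prop)
          (DefFun.snoc (by fun_prop) (DefFun.sub (by fun_prop) (hβ.comp (by fun_prop)))))))
    exact defMapOn_iff.2 (h.congr fun p => by simp [A', φ', and_assoc])
  · have h : DefPred L fun p : (Fin (m + 1) → ℝ) × (Fin (m + 1) → ℝ) =>
        ∃ u, (init p.1 ∈ B ∧ u = ψ (init p.1)) ∧ u ∈ U ∧
          p.2 = snoc u (p.1 (Fin.last m) + β u) :=
      DefPred.ex (DefPred.and (hψdef.comp
        (f := fun q : ((Fin (m + 1) → ℝ) × (Fin (m + 1) → ℝ)) × (Fin m → ℝ) => (init q.1.1, q.2))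
        (by fun_prop)) (DefPred.and hUdef.comp_snd (DefPred.eq (by fun_prop)
          (DefFun.snoc (by fun_prop) (DefFun.add (by fun_prop) (hβ.comp (by fun_prop)))))))
    exact defMapOn_iff.2 (h.congr fun p => by simp [B', ψ', and_assoc])
  · have h : ContDiffOn ℝ r (fun y => ψ (init y)) B' := hψ.comp hinit fun y hy => hy.1
    exact ContDiffOn.snoc h (hlast.add (hβU.comp h fun y hy => hy.2))
  · ext i
    induction i using Fin.lastCases with
    | last => simp [φ', ha.2]
    | cast i => simp [φ', hφa]
  · have hy' := hiff (init y) hy.1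
    constructor
    · rintro ⟨h1, h2⟩ i hi
      induction i using Fin.lastCases with
      | last => simp [φ', h2]
      | cast i =>
        have := hy'.1 h1 i (by have := i.2; simp at hi; omega)
        simpa [φ'] using this
    · intro h
      refine ⟨hy'.2 fun i hi => ?_, ?_⟩
      · simpa [φ'] using h i.castSucc (by simp [hi])
      · simpa [φ', sub_eq_zero] using h (Fin.last m) (by simp)

theorem isClosed_graphOver {M : Set (Fin m → ℝ)} {β : (Fin m → ℝ) → ℝ}
    (hK : IsClosed (closure M \ M))
    (hβ : ∀ x ∈ M, ContinuousAt β x ∧ (Metric.infDist x (closure M \ M))⁻¹ ≤ β x) :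
    IsClosed (graphOver M β) := by
  refine isClosed_of_closure_subset fun y hy => ?_
  obtain ⟨u, hu, huy⟩ := mem_closure_iff_seq_limit.1 hy
  have h1 : Filter.Tendsto (fun k => init (u k)) Filter.atTop (𝓝 (init y)) :=
    (continuous_init.tendsto y).comp huy
  have h2 : Filter.Tendsto (fun k => β (init (u k))) Filter.atTop (𝓝 (y (Fin.last m))) :=
    (((continuous_apply (Fin.last m)).tendsto y).comp huy).congr fun k => (hu k).2
  by_cases hyM : init y ∈ M
  · exact ⟨hyM, tendsto_nhds_unique h2 ((hβ _ hyM).1.tendsto.comp h1)⟩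
  · have hyK : init y ∈ closure M \ M :=
      ⟨mem_closure_of_tendsto h1 (Filter.Eventually.of_forall fun k => (hu k).1), hyM⟩
    have h3 := h2.mul (((Metric.continuous_infDist_pt (closure M \ M)).tendsto (init y)).comp h1)
    rw [Metric.infDist_zero_of_mem hyK, mul_zero] at h3
    have h4 : (1 : ℝ) ≤ 0 := ge_of_tendsto h3 (Filter.Eventually.of_forall fun k => by
      have hpos := (hK.notMem_iff_infDist_pos ⟨_, hyK⟩).1 fun h => h.2 (hu k).1
      exact (inv_le_iff_one_le_mul₀ hpos).1 (hβ _ (hu k).1).2)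
    exact absurd h4 (by norm_num)

theorem exists_closed_graph {r d : ℕ} {M : Set (Fin m → ℝ)} (hM : IsDefCrSubmanifold L r m d M) :
    ∃ (M' : Set (Fin (m + 1) → ℝ)) (d' : ℕ),
      IsDefCrSubmanifold L r (m + 1) d' M' ∧ IsClosed M' ∧
      ∃ (f : (Fin m → ℝ) → (Fin (m + 1) → ℝ)) (g : (Fin (m + 1) → ℝ) → (Fin m → ℝ)),
        DefCrMapOn L r m (m + 1) M f ∧ DefCrMapOn L r (m + 1) m M' g ∧
        Set.BijOn f M M' ∧ Set.InvOn g f M M' := by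
  have hMdef : DefPred L (· ∈ M) := hM.1
  have hK := hM.isClosed_closure_diff
  have hKdef : DefPred L (· ∈ closure M \ M) := DefPred.and (DefPred.closure hMdef) hMdef.not
  have hMU : M ⊆ (closure M \ M)ᶜ := fun x hx h => h.2 hx
  obtain ⟨β, hβ, hβr⟩ := dominates L r (Fin m) (closure M \ M)ᶜ
    (fun x => (Metric.infDist x (closure M \ M))⁻¹) hK.isOpen_compl hKdef.not
    (DefFun.infDist hKdef).inv fun x hx => exists_eventually_inv_infDist_le hK hx
  have hsub := hM.graphOver hK.isOpen_compl hKdef.not hMU hβ fun x hx => (hβr x hx).1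
  have hinv : InvOn init (fun x => snoc x (β x)) M (graphOver M β) :=
    ⟨fun x _ => init_snoc x _, fun y hy => by simp [← hy.2]⟩
  refine ⟨graphOver M β, min d m, hsub,
    isClosed_graphOver hK fun x hx => ⟨(hβr x (hMU hx)).1.continuousAt, (hβr x (hMU hx)).2⟩,
    fun x => snoc x (β x), init, ⟨defMapOn_of_defFun hMdef (by fun_prop), fun a ha => ?_⟩,
    ⟨defMapOn_of_defFun hsub.1 (by fun_prop), fun a ha => ?_⟩,
    hinv.bijOn (fun x hx => ⟨by simpa using hx, by simp⟩) fun y hy => hy.1, hinv⟩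
  · exact ⟨(closure M \ M)ᶜ, _, hMU ha, hK.isOpen_compl,
      ContDiffOn.snoc contDiffOn_id fun x hx => (hβr x hx).1.contDiffWithinAt, fun _ _ => rfl⟩
  · exact ⟨univ, init, trivial, isOpen_univ, contDiff_init.contDiffOn, fun _ _ => rfl⟩

end

/-- every definable `C^r` submanifold of `ℝ^m` is definably `C^r`
diffeomorphic to a definable `C^r` submanifold of `ℝ^{m+1}` which is closed in `ℝ^{m+1}`. -/
theorem statement13
    (hfield : ExpandsOrderedField L) (hlom : LocallyOMinimal L)
    (r m d : ℕ) (M : Set (Fin m → ℝ)) (hM : IsDefCrSubmanifold L r m d M) :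
    ∃ (M' : Set (Fin (m + 1) → ℝ)) (d' : ℕ),
      IsDefCrSubmanifold L r (m + 1) d' M' ∧ IsClosed M' ∧
      ∃ (f : (Fin m → ℝ) → (Fin (m + 1) → ℝ)) (g : (Fin (m + 1) → ℝ) → (Fin m → ℝ)),
        DefCrMapOn L r m (m + 1) M f ∧ DefCrMapOn L r (m + 1) m M' g ∧
        Set.BijOn f M M' ∧ Set.InvOn g f M M' :=
  haveI : LocallyOMinimalField L := ⟨hfield, hlom⟩
  exists_closed_graph hM

end Paper
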